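/- arXiv:2211.04394 — 6 statements merged into one kernel-verified Lean document; each statement's English description precedes it below -/
import Mathlib

section
/- The little finitistic dimension conjecture holds for all finite dimensional algebras if and only if finiteness of the little finitistic dimension is left-right symmetric. Precisely: (for every field k and every finite dimensional k-algebra Λ, findim Λ < ∞) if and only if (for every field k and every finite dimensional k-algebra Λ, findim Λ < ∞ implies findim Λᵒᵖ < ∞). -/
universe u

/-- `ProjDimLE R n M` : the left `R`-module `M` has projective dimension `≤ n`. -/
def ProjDimLE (R : Type u) [Ring R] :
    ℕ → (M : Type u) → [AddCommGroup M] → [Module R M] → Prop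
  | 0, M, _, _ => Module.Projective R M
  | (n+1), M, _, _ => ∃ (P : Type u) (_ : AddCommGroup P) (_ : Module R P)
      (f : P →ₗ[R] M), Module.Projective R P ∧ Function.Surjective f ∧
        ProjDimLE R n (LinearMap.ker f)

/-- The projective dimension of `M` as a left `R`-module, valued in `ℕ∞`
(equal to `⊤` if no finite projective resolution exists). -/
noncomputable def projDim (R : Type u) [Ring R]
    (M : Type u) [AddCommGroup M] [Module R M] : ℕ∞ :=
  sInf ((↑) '' {n : ℕ | ProjDimLE R n M})

/-- The little finitistic dimension of a ring `Λ`: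
the supremum of the projective dimensions of the finitely generated right
`Λ`-modules (i.e. left `Λᵐᵒᵖ`-modules) of finite projective dimension. -/
noncomputable def findim (Λ : Type u) [Ring Λ] : ℕ∞ :=
  sSup {d : ℕ∞ | ∃ (M : Type u) (_ : AddCommGroup M) (_ : Module Λᵐᵒᵖ M),
    Module.Finite Λᵐᵒᵖ M ∧ projDim Λᵐᵒᵖ M = d ∧ d ≠ ⊤}

/-- The big finitistic dimension of a ring `Λ`:
the supremum of the projective dimensions of all right
`Λ`-modules (i.e. left `Λᵐᵒᵖ`-modules) of finite projective dimension. -/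
noncomputable def FinDim (Λ : Type u) [Ring Λ] : ℕ∞ :=
  sSup {d : ℕ∞ | ∃ (M : Type u) (_ : AddCommGroup M) (_ : Module Λᵐᵒᵖ M),
    projDim Λᵐᵒᵖ M = d ∧ d ≠ ⊤}

section Syzygy
open CategoryTheory

theorem projDimLE_iff_cat (R : Type u) [Ring R] (n : ℕ) : ∀ (M : Type u) [AddCommGroup M]
    [Module R M], ProjDimLE R n M ↔ HasProjectiveDimensionLT (ModuleCat.of R M) (n + 1) := by
  induction n with
  | zero =>
    intro M _ _
    rw [zero_add, ← projective_iff_hasProjectiveDimensionLT_one, ← IsProjective.iff_projective]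
    rfl
  | succ n ih =>
    intro M _ _
    constructor
    · rintro ⟨P, _, _, f, hP, hf, hk⟩
      have hS := LinearMap.shortExact_shortComplexKer hf
      rw [ih] at hk
      exact (hS.hasProjectiveDimensionLT_X₃_iff n
        ((IsProjective.iff_projective P).1 hP)).2 hk
    · intro h
      have hf : Function.Surjective (Finsupp.linearCombination R (id : M → M)) :=
        Finsupp.linearCombination_id_surjective R M
      have hS := LinearMap.shortExact_shortComplexKer hf
      refine ⟨M →₀ R, inferInstance, inferInstance, _, inferInstance, hf, ?_⟩
      rw [ih]
      exact (hS.hasProjectiveDimensionLT_X₃_iff n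
        ((IsProjective.iff_projective (M →₀ R)).1 inferInstance)).1 h

theorem projDimLE_succ_iff (R : Type u) [Ring R] (n : ℕ) {K P M : Type u} [AddCommGroup M]
    [Module R M] [AddCommGroup P] [Module R P] [AddCommGroup K] [Module R K]
    (i : K →ₗ[R] P) (f : P →ₗ[R] M) (hP : Module.Projective R P)
    (hi : Function.Injective i) (hf : Function.Surjective f) (hif : Function.Exact i f) :
    ProjDimLE R (n + 1) M ↔ ProjDimLE R n K := by
  rw [projDimLE_iff_cat, projDimLE_iff_cat]
  let S : ShortComplex (ModuleCat.{u} R) :=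
    ShortComplex.mk (ModuleCat.ofHom i) (ModuleCat.ofHom f) (by
      ext x; exact hif.apply_apply_eq_zero x)
  have hS : S.ShortExact :=
    { exact := (ShortComplex.ShortExact.moduleCat_exact_iff_function_exact S).2 hif
      mono_f := (ModuleCat.mono_iff_injective _).2 hi
      epi_g := (ModuleCat.epi_iff_surjective _).2 hf }
  exact hS.hasProjectiveDimensionLT_X₃_iff n ((IsProjective.iff_projective P).1 hP)

end Syzygy

section Transfer

theorem projective_transfer {S A : Type u} [Ring S] [Ring A] (φ : S →+* A) (s : A →+ S)
    (hs : ∀ t a, s (φ t * a) = t * s a) (hφs : ∀ a, φ (s a) = a)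
    (X : Type u) [AddCommGroup X] [Module A X] [Module S X]
    (h : ∀ (t : S) (x : X), t • x = φ t • x) :
    Module.Projective A X ↔ Module.Projective S X := by
  constructor
  · rintro ⟨σ, hσ⟩
    refine ⟨⟨{ toFun := fun x => Finsupp.mapRange s s.map_zero (σ x)
               map_add' := ?_
               map_smul' := ?_ }, ?_⟩⟩
    · intro x y
      ext z
      simp
    · intro t x
      ext z
      simp [h, hs]
    · intro x
      have := hσ x
      simp only [Finsupp.linearCombination_apply, LinearMap.coe_mk, AddHom.coe_mk] at this ⊢
      rw [Finsupp.sum_mapRange_index (by simp)]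
      simpa [h, hφs] using this
  · rintro ⟨σ, hσ⟩
    refine ⟨⟨{ toFun := fun x => Finsupp.mapRange φ φ.map_zero (σ x)
               map_add' := ?_
               map_smul' := ?_ }, ?_⟩⟩
    · intro x y
      ext z
      simp
    · intro a x
      obtain ⟨t, rfl⟩ : ∃ t, φ t = a := ⟨s a, hφs a⟩
      ext z
      simp [← h]
    · intro x
      have := hσ x
      simp only [Finsupp.linearCombination_apply, LinearMap.coe_mk, AddHom.coe_mk] at this ⊢
      rw [Finsupp.sum_mapRange_index (by simp)]
      simpa [← h] using this

theorem projDimLE_transfer {S A : Type u} [Ring S] [Ring A] (φ : S →+* A) (s : A →+ S)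
    (hs : ∀ t a, s (φ t * a) = t * s a) (hφs : ∀ a, φ (s a) = a) (n : ℕ) :
    ∀ (X : Type u) [AddCommGroup X] [Module A X] [Module S X]
    (_ : ∀ (t : S) (x : X), t • x = φ t • x), ProjDimLE A n X ↔ ProjDimLE S n X := by
  induction n with
  | zero =>
    intro X _ _ _ h
    exact projective_transfer φ s hs hφs X h
  | succ n ih =>
    intro X _ _ _ h
    let f : (X →₀ A) →ₗ[A] X := Finsupp.linearCombination A (id : X → X)
    have hf : Function.Surjective f := Finsupp.linearCombination_id_surjective A X
    have hA : ProjDimLE A (n + 1) X ↔ ProjDimLE A n (LinearMap.ker f) :=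
      projDimLE_succ_iff A n (LinearMap.ker f).subtype f inferInstance Subtype.val_injective hf
        (LinearMap.exact_subtype_ker_map f)
    let : Module S (X →₀ A) := Module.compHom _ φ
    let : Module S (LinearMap.ker f) := Module.compHom _ φ
    have hP : Module.Projective A (X →₀ A) := inferInstance
    have hPS : Module.Projective S (X →₀ A) :=
      (projective_transfer φ s hs hφs _ (fun _ _ => rfl)).1 hP
    let fS : (X →₀ A) →ₗ[S] X :=
      { toFun := f, map_add' := f.map_add, map_smul' := fun t x => by
          simp only [RingHom.id_apply]
          rw [h]
          exact f.map_smul (φ t) x }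
    let iS : LinearMap.ker f →ₗ[S] (X →₀ A) :=
      { toFun := fun x => x.1, map_add' := fun _ _ => rfl, map_smul' := fun t x => rfl }
    have hex : Function.Exact iS fS := fun x => LinearMap.exact_subtype_ker_map f x
    have hinj : Function.Injective iS := Subtype.val_injective
    have hsurj : Function.Surjective fS := hf
    have hB : ProjDimLE S (n + 1) X ↔ ProjDimLE S n (LinearMap.ker f) :=
      projDimLE_succ_iff S n iS fS hPS hinj hsurj hex
    rw [hA, hB]
    exact ih _ (fun _ _ => rfl)

end Transfer

section Bass

open MulOpposite

/-- every nonzero right module has a nonzero map to the regular one -/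
def Cogen (B : Type u) [Ring B] : Prop :=
  ∀ (C : Type u) [AddCommGroup C] [Module Bᵐᵒᵖ C] [Nontrivial C], ∃ G : C →ₗ[Bᵐᵒᵖ] B, G ≠ 0

theorem exists_dual_basis (B : Type u) [Ring B] (P : Type u) [AddCommGroup P] [Module B P]
    [Module.Projective B P] [Module.Finite B P] :
    ∃ (m : ℕ) (x : Fin m → P) (ξ : Fin m → (P →ₗ[B] B)), ∀ p, ∑ i, ξ i p • x i = p := by
  obtain ⟨m, g, hg⟩ := Module.Finite.exists_fin' B P
  obtain ⟨s, hs⟩ := Module.projective_lifting_property g LinearMap.id hg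
  refine ⟨m, fun i => g (Pi.single i 1), fun i => (LinearMap.proj i).comp s, fun p => ?_⟩
  have : g (s p) = p := LinearMap.congr_fun hs p
  conv_rhs => rw [← this, pi_eq_sum_univ' (s p), map_sum]
  simp only [map_smul, LinearMap.comp_apply, LinearMap.proj_apply]

theorem exists_retraction (B : Type u) [Ring B] (hB : Cogen B) {P Q : Type u} [AddCommGroup P]
    [Module B P] [AddCommGroup Q] [Module B Q]
    [Module.Projective B P] [Module.Finite B P] [Module.Projective B Q]
    (f : P →ₗ[B] Q) (hf : Function.Injective f) : ∃ r : Q →ₗ[B] P, r ∘ₗ f = LinearMap.id := by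
  obtain ⟨m, x, ξ, hx⟩ := exists_dual_basis B P
  let F : (Q →ₗ[B] B) →ₗ[Bᵐᵒᵖ] (P →ₗ[B] B) :=
    { toFun := fun ζ => ζ ∘ₗ f, map_add' := fun _ _ => rfl, map_smul' := fun _ _ => rfl }
  have hF : LinearMap.range F = ⊤ := by
    by_contra hne
    have : Nontrivial ((P →ₗ[B] B) ⧸ LinearMap.range F) :=
      Submodule.Quotient.nontrivial_iff.2 hne
    obtain ⟨G, hG⟩ := hB ((P →ₗ[B] B) ⧸ LinearMap.range F)
    apply hG
    let G' : (P →ₗ[B] B) →ₗ[Bᵐᵒᵖ] B := G ∘ₗ (LinearMap.range F).mkQ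
    have key : ∀ η : P →ₗ[B] B, G' η = η (∑ i, G' (ξ i) • x i) := by
      intro η
      have : η = ∑ i, op (η (x i)) • ξ i := by
        ext p
        conv_lhs => rw [← hx p]
        simp
      conv_lhs => rw [this]
      simp
    have h0 : (∑ i, G' (ξ i) • x i) = 0 := by
      apply hf
      rw [map_zero]
      set p := ∑ i, G' (ξ i) • x i
      have hz : ∀ ζ : Q →ₗ[B] B, ζ (f p) = 0 := by
        intro ζ
        change (F ζ) p = 0
        rw [← key]
        change G ((LinearMap.range F).mkQ (F ζ)) = 0
        have : (LinearMap.range F).mkQ (F ζ) = 0 :=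
          (Submodule.Quotient.mk_eq_zero _).2 ⟨ζ, rfl⟩
        rw [this, map_zero]
      obtain ⟨σ, hσ⟩ := (inferInstance : Module.Projective B Q)
      have hs0 : σ (f p) = 0 := by
        ext q
        exact hz ((Finsupp.lapply q) ∘ₗ σ)
      rw [← hσ (f p), hs0, map_zero]
    apply Submodule.linearMap_qext
    ext η
    change G' η = 0
    rw [key, h0, map_zero]
  have : ∀ i, ∃ ζ, F ζ = ξ i := fun i => LinearMap.range_eq_top.1 hF _
  choose ζ hζ using this
  refine ⟨∑ i, (ζ i).smulRight (x i), ?_⟩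
  ext p
  simp only [LinearMap.comp_apply, LinearMap.sum_apply, LinearMap.smulRight_apply,
    LinearMap.id_apply]
  conv_rhs => rw [← hx p]
  refine Finset.sum_congr rfl fun i _ => ?_
  rw [← hζ i]
  rfl

theorem projective_of_projDimLE (B : Type u) [Ring B] [IsNoetherianRing B] (hB : Cogen B) (n : ℕ) :
    ∀ (M : Type u) [AddCommGroup M] [Module B M] [Module.Finite B M], ProjDimLE B n M →
      Module.Projective B M := by
  induction n with
  | zero => intro M _ _ _ h; exact h
  | succ n ih =>
    intro M _ _ _ h
    obtain ⟨m, g, hg⟩ := Module.Finite.exists_fin' B M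
    rw [projDimLE_succ_iff B n (LinearMap.ker g).subtype g inferInstance Subtype.val_injective hg
      (LinearMap.exact_subtype_ker_map g)] at h
    have := ih _ h
    obtain ⟨r, hr⟩ := exists_retraction B hB (LinearMap.ker g).subtype Subtype.val_injective
    have := ((LinearMap.exact_subtype_ker_map g).split_tfae
      Subtype.val_injective hg).out 1 0
    obtain ⟨l, hl⟩ := this.1 ⟨r, hr⟩
    exact Module.Projective.of_split l g hl

end Bass

section Construction

open MulOpposite

/-- the triangular algebra -/
def TT (k A : Type u) [Field k] [Ring A] [Algebra k A] : Type u :=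
  A × k × (A →ₗ[k] k) × k

variable (k A : Type u) [Field k] [Ring A] [Algebra k A]

noncomputable instance : AddCommGroup (TT k A) :=
  inferInstanceAs (AddCommGroup (A × k × (A →ₗ[k] k) × k))
noncomputable instance : Module k (TT k A) :=
  inferInstanceAs (Module k (A × k × (A →ₗ[k] k) × k))

variable {k A} in
theorem TT.ext' {x y : TT k A} (h1 : x.1 = y.1) (h2 : x.2.1 = y.2.1)
    (h3 : ∀ a, x.2.2.1 a = y.2.2.1 a) (h4 : x.2.2.2 = y.2.2.2) : x = y :=
  Prod.ext h1 (Prod.ext h2 (Prod.ext (LinearMap.ext h3) h4))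

variable {k A} in
/-- constructor -/
def TT.mk (a : A) (b : k) (n : A →ₗ[k] k) (c : k) : TT k A := (a, b, n, c)

noncomputable instance : Mul (TT k A) := ⟨fun x y =>
  TT.mk (x.1 * y.1) (x.2.1 * y.2.1)
    (y.2.2.1 ∘ₗ LinearMap.mulRight k x.1 + y.2.1 • x.2.2.1) (x.2.1 * y.2.2.2 + x.2.2.2 * y.2.1)⟩
noncomputable instance : One (TT k A) := ⟨TT.mk 1 1 0 0⟩

variable {k A}
theorem TT.mul_def (x y : TT k A) : x * y = TT.mk (x.1 * y.1) (x.2.1 * y.2.1)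
    (y.2.2.1 ∘ₗ LinearMap.mulRight k x.1 + y.2.1 • x.2.2.1)
    (x.2.1 * y.2.2.2 + x.2.2.2 * y.2.1) := rfl
theorem TT.one_def : (1 : TT k A) = TT.mk 1 1 0 0 := rfl
theorem TT.zero_def : (0 : TT k A) = TT.mk 0 0 0 0 := rfl
theorem TT.add_def (x y : TT k A) : x + y = TT.mk (x.1 + y.1) (x.2.1 + y.2.1)
    (x.2.2.1 + y.2.2.1) (x.2.2.2 + y.2.2.2) := rfl
theorem TT.smul_def (t : k) (y : TT k A) : t • y = TT.mk (t • y.1) (t * y.2.1)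
    (t • y.2.2.1) (t * y.2.2.2) := rfl
theorem TT.mk_1 (a : A) (b : k) (n : A →ₗ[k] k) (c : k) : (TT.mk a b n c).1 = a := rfl
theorem TT.mk_2 (a : A) (b : k) (n : A →ₗ[k] k) (c : k) : (TT.mk a b n c).2.1 = b := rfl
theorem TT.mk_3 (a : A) (b : k) (n : A →ₗ[k] k) (c : k) : (TT.mk a b n c).2.2.1 = n := rfl
theorem TT.mk_4 (a : A) (b : k) (n : A →ₗ[k] k) (c : k) : (TT.mk a b n c).2.2.2 = c := rfl

noncomputable instance : Ring (TT k A) :=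
  { (inferInstance : AddCommGroup (TT k A)), (inferInstance : Mul (TT k A)),
    (inferInstance : One (TT k A)) with
    left_distrib := by
      intro x y z
      apply TT.ext' <;> intros <;>
      simp [TT.mul_def, TT.add_def, TT.mk_1, TT.mk_2, TT.mk_3, TT.mk_4, mul_add] <;> ring
    right_distrib := by
      intro x y z
      apply TT.ext' <;> intros <;>
      simp [TT.mul_def, TT.add_def, TT.mk_1, TT.mk_2, TT.mk_3, TT.mk_4, mul_add, add_mul] <;> ring
    zero_mul := by
      intro x
      apply TT.ext' <;> intros <;>
      simp [TT.mul_def, TT.zero_def, TT.mk_1, TT.mk_2, TT.mk_3, TT.mk_4]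
    mul_zero := by
      intro x
      apply TT.ext' <;> intros <;>
      simp [TT.mul_def, TT.zero_def, TT.mk_1, TT.mk_2, TT.mk_3, TT.mk_4]
    mul_assoc := by
      intro x y z
      apply TT.ext' <;> intros <;>
      simp [TT.mul_def, TT.mk_1, TT.mk_2, TT.mk_3, TT.mk_4, mul_assoc] <;> ring
    one_mul := by
      intro x
      apply TT.ext' <;> intros <;>
      simp [TT.mul_def, TT.one_def, TT.mk_1, TT.mk_2, TT.mk_3, TT.mk_4]
    mul_one := by
      intro x
      apply TT.ext' <;> intros <;>
      simp [TT.mul_def, TT.one_def, TT.mk_1, TT.mk_2, TT.mk_3, TT.mk_4]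
    neg_add_cancel := neg_add_cancel
    zsmul := (inferInstance : AddCommGroup (TT k A)).zsmul }

noncomputable instance : Algebra k (TT k A) := Algebra.ofModule
  (by
    intro r x y
    apply TT.ext' <;> intros <;>
      simp [TT.mul_def, TT.smul_def, TT.mk_1, TT.mk_2, TT.mk_3, TT.mk_4] <;> ring)
  (by
    intro r x y
    apply TT.ext' <;> intros <;>
      simp [TT.mul_def, TT.smul_def, TT.mk_1, TT.mk_2, TT.mk_3, TT.mk_4] <;> ring)

instance [FiniteDimensional k A] : FiniteDimensional k (TT k A) :=
  inferInstanceAs (FiniteDimensional k (A × k × (A →ₗ[k] k) × k))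

/-- projection -/
noncomputable def TT.proj : TT k A →+* A where
  toFun x := x.1
  map_one' := rfl
  map_mul' _ _ := rfl
  map_zero' := rfl
  map_add' _ _ := rfl

/-- section -/
noncomputable def TT.sec : A →+ TT k A where
  toFun a := TT.mk a 0 0 0
  map_zero' := rfl
  map_add' a b := by
    apply TT.ext' <;> intros <;>
      simp [TT.add_def, TT.mk_1, TT.mk_2, TT.mk_3, TT.mk_4]

theorem TT.sec_mul (t : TT k A) (a : A) : TT.sec (TT.proj t * a) = t * TT.sec (k := k) a := by
  change TT.mk (t.1 * a) 0 0 0 = t * TT.mk a 0 0 0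
  apply TT.ext' <;> intros <;>
      simp [TT.mul_def, TT.mk_1, TT.mk_2, TT.mk_3, TT.mk_4]

theorem TT.exists_hom (C : Type u) [AddCommGroup C] [Module (TT k A) C] [Nontrivial C] :
    ∃ G : C →ₗ[TT k A] TT k A, G ≠ 0 := by
  let : Module k C := Module.compHom C (algebraMap k (TT k A))
  have : IsScalarTower k (TT k A) C := IsScalarTower.of_algebraMap_smul fun _ _ => rfl
  let W : Submodule k C := Submodule.span k
    {z | ∃ (n : A →ₗ[k] k) (c : k) (y : C), z = (TT.mk 0 0 n c) • y}
  have hW : W ≠ ⊤ := by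
    intro hW
    have h1 : ∀ (n : A →ₗ[k] k) (c : k) (y : C), (TT.mk 0 0 n c) • y = 0 := by
      intro n c y
      have hy : y ∈ W := hW ▸ Submodule.mem_top
      induction hy using Submodule.span_induction with
      | mem z hz =>
        obtain ⟨n', c', z, rfl⟩ := hz
        rw [smul_smul]
        have : TT.mk 0 0 n c * TT.mk 0 0 n' c' = 0 := by
          apply TT.ext' <;> intros <;>
            simp [TT.mul_def, TT.zero_def, TT.mk_1, TT.mk_2, TT.mk_3, TT.mk_4]
        rw [this, zero_smul]
      | zero => simp
      | add x y _ _ hx hy => rw [smul_add, hx, hy, add_zero]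
      | smul a x _ hx => rw [smul_comm, hx, smul_zero]
    have h2 : W = ⊥ := by
      rw [Submodule.span_eq_bot]
      rintro z ⟨n, c, y, rfl⟩
      exact h1 n c y
    exact bot_ne_top (h2.symm.trans hW)
  obtain ⟨φ, hφ, hφW⟩ := W.exists_le_ker_of_lt_top (lt_top_iff_ne_top.2 hW)
  have hN : ∀ (n : A →ₗ[k] k) (c : k) (y : C), φ ((TT.mk 0 0 n c) • y) = 0 := fun n c y =>
    hφW (Submodule.subset_span ⟨n, c, y, rfl⟩)
  let L : C → A →ₗ[k] k := fun y =>
    { toFun := fun a => φ ((TT.mk a 0 0 0 : TT k A) • y)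
      map_add' := fun a b => by
        rw [← map_add, ← add_smul]
        congr 2
        exact TT.sec.map_add a b
      map_smul' := fun t a => by
        rw [RingHom.id_apply, ← map_smul, ← smul_assoc]
        congr 2
        apply TT.ext' <;> intros <;> simp [TT.smul_def, TT.mk_1, TT.mk_2, TT.mk_3, TT.mk_4] }
  have hL : ∀ y a, L y a = φ ((TT.mk a 0 0 0 : TT k A) • y) := fun _ _ => rfl
  let E : C → k := fun y => φ ((TT.mk 0 1 0 0 : TT k A) • y)
  have hE : ∀ y, E y = φ ((TT.mk 0 1 0 0 : TT k A) • y) := fun _ => rfl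
  have hLa : ∀ x y a, L (x + y) a = L x a + L y a := fun x y a => by
    rw [hL, hL, hL, smul_add, map_add]
  have hEa : ∀ x y, E (x + y) = E x + E y := fun x y => by
    rw [hE, hE, hE, smul_add, map_add]
  have hLm : ∀ (t : TT k A) y a, L (t • y) a = L y (a * t.1) := fun t y a => by
    rw [hL, hL, smul_smul]
    have : (TT.mk a 0 0 0 : TT k A) * t = TT.mk (a * t.1) 0 0 0 +
        TT.mk 0 0 (t.2.2.1 ∘ₗ LinearMap.mulRight k a) 0 := by
      apply TT.ext' <;> intros <;>
        simp [TT.add_def, TT.mul_def, TT.mk_1, TT.mk_2, TT.mk_3, TT.mk_4]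
    rw [this, add_smul, map_add, hN, add_zero]
  have hEm : ∀ (t : TT k A) y, E (t • y) = t.2.1 * E y := fun t y => by
    rw [hE, hE, smul_smul]
    have : (TT.mk 0 1 0 0 : TT k A) * t = (t.2.1 : k) • (TT.mk 0 1 0 0 : TT k A) +
        TT.mk 0 0 0 t.2.2.2 := by
      apply TT.ext' <;> intros <;>
        simp [TT.add_def, TT.mul_def, TT.smul_def, TT.mk_1, TT.mk_2, TT.mk_3, TT.mk_4]
    rw [this, add_smul, map_add, hN, add_zero, smul_assoc, map_smul, smul_eq_mul]
  let G : C →ₗ[TT k A] TT k A :=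
    { toFun := fun y => TT.mk 0 0 (L y) (E y)
      map_add' := fun x y => by
        apply TT.ext' <;> intros <;>
          simp only [TT.add_def, TT.mk_1, TT.mk_2, TT.mk_3, TT.mk_4, hLa, hEa, add_zero,
            LinearMap.add_apply]
      map_smul' := fun t y => by
        apply TT.ext' <;> intros <;>
          simp [TT.mul_def, TT.mk_1, TT.mk_2, TT.mk_3, TT.mk_4, hLm, hEm] }
  refine ⟨G, fun h => hφ ?_⟩
  ext y
  have h0 : TT.mk 0 0 (L y) (E y) = 0 := LinearMap.congr_fun h y
  have h3 : L y 1 = 0 := by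
    have : L y = 0 := congrArg (fun t : TT k A => t.2.2.1) h0
    rw [this]; rfl
  have h4 : φ ((TT.mk 0 1 0 0 : TT k A) • y) = 0 := congrArg (fun t : TT k A => t.2.2.2) h0
  have h1 : (1 : TT k A) = TT.mk 1 0 0 0 + TT.mk 0 1 0 0 := by
    apply TT.ext' <;> intros <;>
      simp [TT.add_def, TT.one_def, TT.mk_1, TT.mk_2, TT.mk_3, TT.mk_4]
  rw [← one_smul (TT k A) y, h1, add_smul, map_add, h4, ← hL, h3]
  simp

theorem TT.cogen : Cogen (TT k A)ᵐᵒᵖ := by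
  intro C _ _ _
  let : Module (TT k A) C := Module.compHom C
    ((RingEquiv.opOp (TT k A)).toRingHom : TT k A →+* (TT k A)ᵐᵒᵖᵐᵒᵖ)
  obtain ⟨G, hG⟩ := TT.exists_hom (k := k) (A := A) C
  refine ⟨{ toFun := fun c => op (G c), map_add' := fun x y => by simp, map_smul' := ?_ }, ?_⟩
  · intro t c
    have := G.map_smul t.unop.unop c
    change G (t • c) = _ at this
    rw [this]
    rfl
  · intro h
    apply hG
    ext c
    exact op_injective (LinearMap.congr_fun h c)

end Construction

theorem projDim_transfer {S A : Type u} [Ring S] [Ring A] (φ : S →+* A) (s : A →+ S)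
    (hs : ∀ t a, s (φ t * a) = t * s a) (hφs : ∀ a, φ (s a) = a)
    (X : Type u) [AddCommGroup X] [Module A X] [Module S X]
    (h : ∀ (t : S) (x : X), t • x = φ t • x) : projDim A X = projDim S X := by
  unfold projDim
  congr 2
  ext n
  exact projDimLE_transfer φ s hs hφs n X h

theorem findim_TT (k A : Type u) [Field k] [Ring A] [Algebra k A] [FiniteDimensional k A] :
    findim (TT k A) < ⊤ := by
  have : IsNoetherianRing (TT k A)ᵐᵒᵖ := IsNoetherianRing.of_finite k _
  refine lt_of_le_of_lt (b := 0) (sSup_le ?_) (by simp)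
  rintro d ⟨M, _, _, hM, rfl, hd⟩
  have : ∃ n, ProjDimLE (TT k A)ᵐᵒᵖ n M := by
    by_contra hcon
    push Not at hcon
    apply hd
    simp [projDim, hcon]
  obtain ⟨n, hn⟩ := this
  have h0 : ProjDimLE (TT k A)ᵐᵒᵖ 0 M := projective_of_projDimLE _ TT.cogen n M hn
  exact sInf_le ⟨0, h0, rfl⟩

theorem findim_le_TT (k Λ : Type u) [Field k] [Ring Λ] [Algebra k Λ] :
    findim Λ ≤ findim (TT k Λᵐᵒᵖ)ᵐᵒᵖ := by
  refine sSup_le_sSup ?_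
  rintro d ⟨M, _, _, hM, rfl, hd⟩
  let e := RingEquiv.opOp (TT k Λᵐᵒᵖ)
  let φ : (TT k Λᵐᵒᵖ)ᵐᵒᵖᵐᵒᵖ →+* Λᵐᵒᵖ := TT.proj.comp e.symm.toRingHom
  let s : Λᵐᵒᵖ →+ (TT k Λᵐᵒᵖ)ᵐᵒᵖᵐᵒᵖ := e.toAddEquiv.toAddMonoidHom.comp TT.sec
  have hφs : ∀ a, φ (s a) = a := fun a => rfl
  have hs : ∀ t a, s (φ t * a) = t * s a := fun t a => by
    have := congrArg e (TT.sec_mul (e.symm t) a)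
    rw [map_mul e, e.apply_symm_apply] at this
    exact this
  let : Module (TT k Λᵐᵒᵖ)ᵐᵒᵖᵐᵒᵖ M := Module.compHom M φ
  have hp := projDim_transfer φ s hs hφs M (fun _ _ => rfl)
  refine ⟨M, inferInstance, inferInstance, ?_, hp.symm, hd⟩
  obtain ⟨S, hS⟩ := hM
  refine ⟨S, ?_⟩
  rw [eq_top_iff]
  intro x _
  have hx : x ∈ Submodule.span Λᵐᵒᵖ (S : Set M) := hS ▸ Submodule.mem_top
  induction hx using Submodule.span_induction with
  | mem z hz => exact Submodule.subset_span hz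
  | zero => exact Submodule.zero_mem _
  | add x y _ _ hx hy => exact Submodule.add_mem _ (hx trivial) (hy trivial)
  | smul a x _ hx =>
    have := Submodule.smul_mem _ (s a) (hx trivial)
    exact this

/-- **Theorem (little finitistic dimension conjecture ⟺ left-right symmetry).**
The little finitistic dimension conjecture holds for all finite dimensional
algebras if and only if, for all finite dimensional algebras `Λ`,
`findim Λ < ∞` implies `findim Λᵒᵖ < ∞`. -/
theorem findim_conjecture_iff_left_right_symmetric :
    (∀ (k Λ : Type u) [Field k] [Ring Λ] [Algebra k Λ] [FiniteDimensional k Λ],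
      findim Λ < ⊤) ↔
    (∀ (k Λ : Type u) [Field k] [Ring Λ] [Algebra k Λ] [FiniteDimensional k Λ],
      findim Λ < ⊤ → findim Λᵐᵒᵖ < ⊤) := by
  constructor
  · intro h k Λ _ _ _ _ _
    exact h k Λᵐᵒᵖ
  · intro h k Λ _ _ _ _
    exact lt_of_le_of_lt (findim_le_TT k Λ) (h k (TT k Λᵐᵒᵖ) (findim_TT k Λᵐᵒᵖ))
end

section
/- The big finitistic dimension conjecture holds for all finite dimensional algebras if and only if finiteness of the big finitistic dimension is left-right symmetric. Precisely: (for every field k and every finite dimensional k-algebra Λ, FinDim Λ < ∞) if and only if (for every field k and every finite dimensional k-algebra Λ, FinDim Λ < ∞ implies FinDim Λᵒᵖ < ∞). -/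
universe u

open CategoryTheory in
theorem hasPD_shift (R : Type u) [Ring R] (K P M : Type u) [AddCommGroup M] [Module R M]
    [AddCommGroup P] [Module R P] [AddCommGroup K] [Module R K]
    (i : K →ₗ[R] P) (g : P →ₗ[R] M) (hP : Module.Projective R P) (hi : Function.Injective i)
    (hex : Function.Exact i g) (hg : Function.Surjective g) (n : ℕ) :
    HasProjectiveDimensionLE (ModuleCat.of R M) (n+1) ↔
      HasProjectiveDimensionLE (ModuleCat.of R K) n := by
  let S : ShortComplex (ModuleCat.{u} R) :=
    ShortComplex.mk (ModuleCat.ofHom i) (ModuleCat.ofHom g) (by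
      rw [← ModuleCat.ofHom_comp, hex.linearMap_comp_eq_zero]; rfl)
  have hS : S.ShortExact := ModuleCat.shortComplex_shortExact S hex hi hg
  have h2 : Projective S.X₂ := (IsProjective.iff_projective P).1 hP
  exact hS.hasProjectiveDimensionLT_X₃_iff n h2

open CategoryTheory in
theorem projDimLE_iff_has (R : Type u) [Ring R] (n : ℕ) :
    ∀ (M : Type u) [AddCommGroup M] [Module R M],
    ProjDimLE R n M ↔ HasProjectiveDimensionLE (ModuleCat.of R M) n := by
  induction n with
  | zero =>
    intro M _ _
    rw [← projective_iff_hasProjectiveDimensionLE_zero, ← IsProjective.iff_projective]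
    rfl
  | succ n ih =>
    intro M _ _
    constructor
    · rintro ⟨P, _, _, f, hP, hf, hk⟩
      rw [hasPD_shift R (LinearMap.ker f) P M (LinearMap.ker f).subtype f hP
        (Submodule.subtype_injective _) (LinearMap.exact_subtype_ker_map f) hf n]
      exact (ih _).1 hk
    · intro h
      have hs : Function.Surjective (Finsupp.linearCombination R (id : M → M)) :=
        Finsupp.linearCombination_id_surjective R M
      refine ⟨M →₀ R, inferInstance, inferInstance, Finsupp.linearCombination R id,
        inferInstance, hs, ?_⟩
      rw [ih]
      exact (hasPD_shift R _ _ M (Submodule.subtype _) _ inferInstance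
        (Submodule.subtype_injective _) (LinearMap.exact_subtype_ker_map _) hs n).1 h

theorem projDimLE_shift (R : Type u) [Ring R] (K P M : Type u) [AddCommGroup M] [Module R M]
    [AddCommGroup P] [Module R P] [AddCommGroup K] [Module R K]
    (i : K →ₗ[R] P) (g : P →ₗ[R] M) (hP : Module.Projective R P) (hi : Function.Injective i)
    (hex : Function.Exact i g) (hg : Function.Surjective g) (n : ℕ) :
    ProjDimLE R (n+1) M ↔ ProjDimLE R n K := by
  rw [projDimLE_iff_has, projDimLE_iff_has]
  exact hasPD_shift R K P M i g hP hi hex hg n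

open CategoryTheory in
theorem projDimLE_mono (R : Type u) [Ring R] (M : Type u) [AddCommGroup M] [Module R M]
    {m n : ℕ} (h : m ≤ n) (hm : ProjDimLE R m M) : ProjDimLE R n M := by
  rw [projDimLE_iff_has] at hm ⊢
  exact hasProjectiveDimensionLT_of_ge _ (m+1) (n+1) (by omega)

/-- all modules of finite projective dimension have dimension at most `d`. -/
def BddPD (R : Type u) [Ring R] (d : ℕ) : Prop :=
  ∀ (M : Type u) [AddCommGroup M] [Module R M] (n : ℕ), ProjDimLE R n M → ProjDimLE R d M

theorem FinDim_lt_top_iff (Λ : Type u) [Ring Λ] : FinDim Λ < ⊤ ↔ ∃ d, BddPD Λᵐᵒᵖ d := by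
  constructor
  · intro h
    obtain ⟨d, hd⟩ := ENat.ne_top_iff_exists.1 h.ne
    refine ⟨d, fun M _ _ n hn => ?_⟩
    have hne : ((↑) '' {n : ℕ | ProjDimLE Λᵐᵒᵖ n M} : Set ℕ∞).Nonempty := ⟨_, n, hn, rfl⟩
    obtain ⟨m, hm, hm'⟩ := csInf_mem hne
    have h1 : projDim Λᵐᵒᵖ M = m := hm'.symm
    have h2 : projDim Λᵐᵒᵖ M ≤ FinDim Λ :=
      le_sSup ⟨M, inferInstance, inferInstance, rfl, by rw [h1]; exact ENat.natCast_ne_top m⟩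
    rw [h1, ← hd] at h2
    exact projDimLE_mono _ _ (by exact_mod_cast h2) hm
  · rintro ⟨d, hd⟩
    refine lt_of_le_of_lt (b := (d : ℕ∞)) (sSup_le ?_) (ENat.natCast_lt_top d)
    rintro _ ⟨M, _, _, rfl, hM⟩
    have : ∃ n, ProjDimLE Λᵐᵒᵖ n M := by
      by_contra hcon
      push Not at hcon
      apply hM
      simp [projDim, hcon]
    obtain ⟨n, hn⟩ := this
    exact sInf_le ⟨d, hd M n hn, rfl⟩

section transfer
variable {S R : Type u} [Ring S] [Ring R] (φ : S →+* R)

theorem proj_up (hR : letI := Module.compHom R φ; Module.Projective S R)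
    (M : Type u) [AddCommGroup M] [Module R M] [Module S M] (hc : ∀ (s : S) (x : M), s • x = φ s • x)
    (hM : Module.Projective R M) : Module.Projective S M := by
  letI : Module S R := Module.compHom R φ
  haveI : Module.Projective S R := hR
  obtain ⟨s, hs⟩ := hM.out
  have hcR : ∀ (a : S) (x : R), a • x = φ a * x := fun _ _ => rfl
  let s' : M →ₗ[S] (M →₀ R) :=
    { toFun := s, map_add' := s.map_add, map_smul' := fun a x => by
        rw [hc, s.map_smul]; ext i; simp [hcR] }
  let t' : (M →₀ R) →ₗ[S] M :=
    { toFun := Finsupp.linearCombination R id, map_add' := map_add _, map_smul' := fun a x => by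
        have : a • x = φ a • x := by ext i; simp [hcR]
        rw [this, map_smul, RingHom.id_apply, hc] }
  classical
  haveI : Module.Projective S (M →₀ R) :=
    Module.Projective.of_equiv (finsuppLequivDFinsupp (ι := M) (M := R) S).symm
  exact Module.Projective.of_split s' t' (LinearMap.ext fun x => hs x)

theorem proj_down (hφ : Function.Surjective φ)
    (M : Type u) [AddCommGroup M] [Module R M] [Module S M] (hc : ∀ (s : S) (x : M), s • x = φ s • x)
    (hM : Module.Projective S M) : Module.Projective R M := by
  letI : Module S R := Module.compHom R φ
  have hcR : ∀ (a : S) (x : R), a • x = φ a * x := fun _ _ => rfl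
  let t' : (M →₀ R) →ₗ[S] M :=
    { toFun := Finsupp.linearCombination R id, map_add' := map_add _, map_smul' := fun a x => by
        have : a • x = φ a • x := by ext i; simp [hcR]
        rw [this, map_smul, RingHom.id_apply, hc] }
  obtain ⟨s, hs⟩ := Module.projective_lifting_property t' LinearMap.id
    (Finsupp.linearCombination_id_surjective R M)
  let s' : M →ₗ[R] (M →₀ R) :=
    { toFun := s, map_add' := s.map_add, map_smul' := fun a x => by
        obtain ⟨a, rfl⟩ := hφ a
        rw [← hc, s.map_smul]; ext i; simp [hcR] }
  exact Module.Projective.of_split s' (Finsupp.linearCombination R id)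
    (LinearMap.ext fun x => LinearMap.congr_fun hs x)

theorem pd_up (hR : letI := Module.compHom R φ; Module.Projective S R) (n : ℕ) :
    ∀ (M : Type u) [AddCommGroup M] [Module R M] [Module S M] (_ : ∀ (s : S) (x : M), s • x = φ s • x),
      ProjDimLE R n M → ProjDimLE S n M := by
  induction n with
  | zero => intro M _ _ _ hc h; exact proj_up φ hR M hc h
  | succ n ih =>
    rintro M _ _ _ hc ⟨P, _, _, f, hP, hf, hk⟩
    letI : Module S P := Module.compHom P φ
    letI : Module S (LinearMap.ker f) := Module.compHom _ φ
    have hK := ih (LinearMap.ker f) (fun _ _ => rfl) hk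
    have hP' := proj_up φ hR P (fun _ _ => rfl) hP
    let f' : P →ₗ[S] M :=
      { toFun := f, map_add' := f.map_add, map_smul' := fun a x => by
                              rw [RingHom.id_apply, hc, ← f.map_smul]; rfl }
    let i' : LinearMap.ker f →ₗ[S] P :=
      { toFun := Subtype.val, map_add' := fun _ _ => rfl, map_smul' := fun a x => rfl }
    exact (projDimLE_shift S _ P M i' f' hP' Subtype.val_injective
      (LinearMap.exact_subtype_ker_map f) hf n).2 hK

theorem pd_down (hφ : Function.Surjective φ)
    (hR : letI := Module.compHom R φ; Module.Projective S R) (n : ℕ) :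
    ∀ (M : Type u) [AddCommGroup M] [Module R M] [Module S M] (_ : ∀ (s : S) (x : M), s • x = φ s • x),
      ProjDimLE S n M → ProjDimLE R n M := by
  induction n with
  | zero => intro M _ _ _ hc h; exact proj_down φ hφ M hc h
  | succ n ih =>
    intro M _ _ _ hc h
    obtain ⟨P, _, _, f, hP, hf⟩ : ∃ (P : Type u) (_ : AddCommGroup P) (_ : Module R P)
      (f : P →ₗ[R] M), Module.Projective R P ∧ Function.Surjective f :=
      ⟨M →₀ R, inferInstance, inferInstance, Finsupp.linearCombination R id,
        inferInstance, Finsupp.linearCombination_id_surjective R M⟩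
    refine ⟨P, _, _, f, hP, hf, ?_⟩
    letI : Module S P := Module.compHom P φ
    letI : Module S (LinearMap.ker f) := Module.compHom _ φ
    have hP' := proj_up φ hR P (fun _ _ => rfl) hP
    let f' : P →ₗ[S] M :=
      { toFun := f, map_add' := f.map_add, map_smul' := fun a x => by
                              rw [RingHom.id_apply, hc, ← f.map_smul]; rfl }
    let i' : LinearMap.ker f →ₗ[S] P :=
      { toFun := Subtype.val, map_add' := fun _ _ => rfl, map_smul' := fun a x => rfl }
    exact ih _ (fun _ _ => rfl) ((projDimLE_shift S _ P M i' f' hP' Subtype.val_injective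
      (LinearMap.exact_subtype_ker_map f) hf n).1 h)

theorem bdd_transfer (hφ : Function.Surjective φ)
    (hR : letI := Module.compHom R φ; Module.Projective S R) (d : ℕ) (h : BddPD S d) :
    BddPD R d := by
  intro M _ _ n hn
  letI : Module S M := Module.compHom M φ
  exact pd_down φ hφ hR d M (fun _ _ => rfl) (h M n (pd_up φ hR n M (fun _ _ => rfl) hn))

theorem bdd_equiv (e : S ≃+* R) (d : ℕ) (h : BddPD S d) : BddPD R d := by
  refine bdd_transfer (e : S →+* R) e.surjective ?_ d h
  letI : Module S R := Module.compHom R (e : S →+* R)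
  let l : S ≃ₗ[S] R :=
    { e.toAddEquiv with map_smul' := fun a x => e.map_mul a x }
  exact Module.Projective.of_equiv l

end transfer

theorem split_of_inj {U : Type u} [Ring U] (J : Ideal U) [J.IsTwoSided] (hnil : IsNilpotent J)
    (hss : IsSemisimpleRing (U ⧸ J))
    (hann : ∀ a : U, (∀ r : U, (∀ j ∈ J, r * j = 0) → r * a = 0) → a ∈ J)
    (P Q : Type u) [AddCommGroup P] [Module U P] [AddCommGroup Q] [Module U Q]
    [Module.Projective U P] [Module.Projective U Q] (f : P →ₗ[U] Q) (hf : Function.Injective f) :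
    ∃ g : Q →ₗ[U] P, g ∘ₗ f = LinearMap.id := by
  have h1 : ∀ p : P, f p ∈ J • (⊤ : Submodule U Q) → p ∈ J • (⊤ : Submodule U P) := by
    intro p hp
    have hr : ∀ r : U, (∀ j ∈ J, r * j = 0) → r • p = 0 := by
      intro r hr
      apply hf
      rw [map_smul, map_zero]
      refine Submodule.smul_induction_on hp (fun j hj n _ => ?_) (fun x y hx hy => ?_)
      · rw [← mul_smul, hr j hj, zero_smul]
      · rw [smul_add, hx, hy, add_zero]
    obtain ⟨s, hs⟩ := (inferInstance : Module.Projective U P).out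
    rw [← hs p, Finsupp.linearCombination_apply]
    refine Submodule.sum_mem _ fun i _ => Submodule.smul_mem_smul (hann _ fun r hr' => ?_) trivial
    have := congrArg s (hr r hr')
    rw [map_smul, map_zero] at this
    simpa using DFunLike.congr_fun this i
  let fb := Submodule.mapQ (J • (⊤ : Submodule U P)) (J • (⊤ : Submodule U Q)) f
    (Submodule.smul_top_le_comap_smul_top J f)
  have hfb : LinearMap.ker fb = ⊥ := by
    rw [LinearMap.ker_eq_bot']
    intro x hx
    obtain ⟨p, rfl⟩ := Submodule.mkQ_surjective _ x
    rw [Submodule.mkQ_apply, Submodule.Quotient.mk_eq_zero]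
    apply h1
    rwa [← Submodule.Quotient.mk_eq_zero]
  have htor : Module.IsTorsionBySet U (Q ⧸ J • (⊤ : Submodule U Q)) J := by
    rintro x ⟨j, hj⟩
    obtain ⟨q, rfl⟩ := Submodule.mkQ_surjective _ x
    change j • Submodule.mkQ _ q = 0
    rw [← map_smul, Submodule.mkQ_apply, Submodule.Quotient.mk_eq_zero]
    exact Submodule.smul_mem_smul hj trivial
  have hsq : IsSemisimpleModule U (Q ⧸ J • (⊤ : Submodule U Q)) := by
    letI := htor.module
    exact htor.isSemisimpleModule_iff.1 inferInstance
  obtain ⟨gb, hgb⟩ := IsSemisimpleModule.extension_property fb (LinearMap.ker_eq_bot.1 hfb)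
    LinearMap.id
  obtain ⟨g, hg⟩ := Module.projective_lifting_property (J • (⊤ : Submodule U P)).mkQ
    (gb ∘ₗ (J • (⊤ : Submodule U Q)).mkQ) (Submodule.mkQ_surjective _)
  let h : Module.End U P := 1 - g ∘ₗ f
  have hh : ∀ p, h p ∈ J • (⊤ : Submodule U P) := by
    intro p
    rw [← Submodule.Quotient.mk_eq_zero, ← Submodule.mkQ_apply]
    have e1 := LinearMap.congr_fun hg (f p)
    have e2 := LinearMap.congr_fun hgb (Submodule.mkQ _ p)
    simp only [h, LinearMap.sub_apply, map_sub, LinearMap.comp_apply, Module.End.one_apply] at *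
    rw [e1]
    rw [sub_eq_zero]
    exact e2.symm
  have hpow : ∀ n : ℕ, ∀ p, (h ^ n) p ∈ J ^ n • (⊤ : Submodule U P) := by
    intro n
    induction n with
    | zero => intro p; rw [Submodule.pow_zero, Submodule.one_smul]; trivial
    | succ n ih =>
      intro p
      rw [pow_succ', Submodule.pow_succ, Module.End.mul_apply, Submodule.mul_smul]
      have : Submodule.map h (J ^ n • (⊤ : Submodule U P)) ≤ J ^ n • J • ⊤ := by
        rw [Submodule.map_smul'']
        refine Submodule.smul_mono le_rfl ?_
        rintro _ ⟨x, _, rfl⟩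
        exact hh x
      exact this ⟨_, ih p, rfl⟩
  have hn : IsNilpotent h := by
    obtain ⟨n, hn⟩ := hnil
    refine ⟨n, LinearMap.ext fun p => ?_⟩
    have := hpow n p
    rw [hn] at this
    simpa using this
  obtain ⟨v, hv⟩ := hn.isUnit_one_sub
  have hv' : (v : Module.End U P) = g ∘ₗ f := by rw [hv]; simp [h]
  refine ⟨(↑v⁻¹ : Module.End U P) ∘ₗ g, ?_⟩
  rw [LinearMap.comp_assoc, ← hv']
  exact v.inv_mul

theorem bdd_zero {U : Type u} [Ring U] (J : Ideal U) [J.IsTwoSided] (hnil : IsNilpotent J)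
    (hss : IsSemisimpleRing (U ⧸ J))
    (hann : ∀ a : U, (∀ r : U, (∀ j ∈ J, r * j = 0) → r * a = 0) → a ∈ J) : BddPD U 0 := by
  intro M _ _ n
  induction n generalizing M with
  | zero => exact id
  | succ n ih =>
    rintro ⟨P, _, _, f, hP, hf, hk⟩
    have hK : Module.Projective U (LinearMap.ker f) := ih _ hk
    obtain ⟨g, hg⟩ := split_of_inj J hnil hss hann _ _ (LinearMap.ker f).subtype
      (Submodule.subtype_injective _)
    have hgx : ∀ x : LinearMap.ker f, g x = x := fun x => LinearMap.congr_fun hg x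
    let q : P →ₗ[U] P := LinearMap.id - (LinearMap.ker f).subtype ∘ₗ g
    have hq : LinearMap.ker f ≤ LinearMap.ker q := by
      intro x hx
      have := hgx ⟨x, hx⟩
      simp only at this
      simp [q, this]
    let s : M →ₗ[U] P := ((LinearMap.ker f).liftQ q hq) ∘ₗ
      (f.quotKerEquivOfSurjective hf).symm.toLinearMap
    refine Module.Projective.of_split s f (LinearMap.ext fun m => ?_)
    obtain ⟨p, rfl⟩ := hf m
    have : (f.quotKerEquivOfSurjective hf).symm (f p) = Submodule.Quotient.mk p := by
      rw [LinearEquiv.symm_apply_eq]; rfl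
    simp [s, this, q]

section construction
variable {k A Q : Type u} [Field k] [Ring A] [Ring Q] [Algebra k A] [Algebra k Q]

/-- The triangular algebra `A × Q × k[y]/(y²)`. -/
def UAlg (_ : A →ₐ[k] Q) : Type u := A × Q × k × k

namespace UAlg
variable (π : A →ₐ[k] Q)

instance : AddCommGroup (UAlg π) := inferInstanceAs (AddCommGroup (A × Q × k × k))
instance : Module k (UAlg π) := inferInstanceAs (Module k (A × Q × k × k))

variable {π}

/-- Constructor. -/
def mk (a : A) (m : Q) (b c : k) : UAlg π := (a, m, b, c)
/-- Component. -/
def pa (x : UAlg π) : A := x.1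
/-- Component. -/
def pm (x : UAlg π) : Q := x.2.1
/-- Component. -/
def pb (x : UAlg π) : k := x.2.2.1
/-- Component. -/
def pc (x : UAlg π) : k := x.2.2.2

theorem ext' {x y : UAlg π} (h1 : x.pa = y.pa) (h2 : x.pm = y.pm) (h3 : x.pb = y.pb)
    (h4 : x.pc = y.pc) : x = y :=
  Prod.ext h1 (Prod.ext h2 (Prod.ext h3 h4))

@[simp] theorem pa_mk (a : A) (m : Q) (b c : k) : (mk a m b c : UAlg π).pa = a := rfl
@[simp] theorem pm_mk (a : A) (m : Q) (b c : k) : (mk a m b c : UAlg π).pm = m := rfl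
@[simp] theorem pb_mk (a : A) (m : Q) (b c : k) : (mk a m b c : UAlg π).pb = b := rfl
@[simp] theorem pc_mk (a : A) (m : Q) (b c : k) : (mk a m b c : UAlg π).pc = c := rfl
@[simp] theorem pa_add (x y : UAlg π) : (x + y).pa = x.pa + y.pa := rfl
@[simp] theorem pm_add (x y : UAlg π) : (x + y).pm = x.pm + y.pm := rfl
@[simp] theorem pb_add (x y : UAlg π) : (x + y).pb = x.pb + y.pb := rfl
@[simp] theorem pc_add (x y : UAlg π) : (x + y).pc = x.pc + y.pc := rfl
@[simp] theorem pa_zero : (0 : UAlg π).pa = 0 := rfl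
@[simp] theorem pm_zero : (0 : UAlg π).pm = 0 := rfl
@[simp] theorem pb_zero : (0 : UAlg π).pb = 0 := rfl
@[simp] theorem pc_zero : (0 : UAlg π).pc = 0 := rfl
@[simp] theorem pa_smul (t : k) (x : UAlg π) : (t • x).pa = t • x.pa := rfl
@[simp] theorem pm_smul (t : k) (x : UAlg π) : (t • x).pm = t • x.pm := rfl
@[simp] theorem pb_smul (t : k) (x : UAlg π) : (t • x).pb = t * x.pb := rfl
@[simp] theorem pc_smul (t : k) (x : UAlg π) : (t • x).pc = t * x.pc := rfl

instance : Mul (UAlg π) :=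
  ⟨fun x y => mk (x.pa * y.pa) (x.pm * π y.pa + x.pb • y.pm) (x.pb * y.pb)
    (x.pb * y.pc + x.pc * y.pb)⟩
instance : One (UAlg π) := ⟨mk 1 0 1 0⟩

@[simp] theorem pa_mul (x y : UAlg π) : (x * y).pa = x.pa * y.pa := rfl
@[simp] theorem pm_mul (x y : UAlg π) : (x * y).pm = x.pm * π y.pa + x.pb • y.pm := rfl
@[simp] theorem pb_mul (x y : UAlg π) : (x * y).pb = x.pb * y.pb := rfl
@[simp] theorem pc_mul (x y : UAlg π) : (x * y).pc = x.pb * y.pc + x.pc * y.pb := rfl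
@[simp] theorem pa_one : (1 : UAlg π).pa = 1 := rfl
@[simp] theorem pm_one : (1 : UAlg π).pm = 0 := rfl
@[simp] theorem pb_one : (1 : UAlg π).pb = 1 := rfl
@[simp] theorem pc_one : (1 : UAlg π).pc = 0 := rfl

instance : Ring (UAlg π) :=
  { (inferInstance : AddCommGroup (UAlg π)), (inferInstance : Mul (UAlg π)),
    (inferInstance : One (UAlg π)) with
    mul_assoc := fun x y z => by
      apply ext' <;> simp [mul_assoc, add_mul, mul_add, add_assoc, mul_smul]
    one_mul := fun x => by apply ext' <;> simp
    mul_one := fun x => by apply ext' <;> simp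
    zero_mul := fun x => by apply ext' <;> simp
    mul_zero := fun x => by apply ext' <;> simp
    left_distrib := fun x y z => by apply ext' <;> simp [mul_add] <;> abel
    right_distrib := fun x y z => by apply ext' <;> simp [add_mul, add_smul] <;> abel }

instance : Algebra k (UAlg π) :=
  Algebra.ofModule
    (fun t x y => by apply ext' <;> simp [mul_assoc, mul_add, mul_smul])
    (fun t x y => by
      apply ext' <;> simp [mul_assoc, mul_add, mul_smul, mul_left_comm, smul_comm t])

instance [FiniteDimensional k A] [FiniteDimensional k Q] : FiniteDimensional k (UAlg π) :=
  inferInstanceAs (FiniteDimensional k (A × Q × k × k))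

variable (π)

/-- Projection to `A`. -/
def toA : UAlg π →+* A where
  toFun := pa
  map_one' := rfl
  map_mul' _ _ := rfl
  map_zero' := rfl
  map_add' _ _ := rfl

/-- Projection to the semisimple quotient. -/
def toD : UAlg π →+* Q × k where
  toFun x := (π x.pa, x.pb)
  map_one' := by simp
  map_mul' _ _ := by simp
  map_zero' := by simp
  map_add' _ _ := by simp

theorem toA_surj : Function.Surjective (toA π) := fun a => ⟨mk a 0 0 0, rfl⟩

theorem bdd (hπ : Function.Surjective π) (hQ : IsSemisimpleRing Q)
    (hnil : IsNilpotent (RingHom.ker π)) : BddPD (UAlg π) 0 := by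
  have hmem : ∀ x : UAlg π, x ∈ RingHom.ker (toD π) ↔ π x.pa = 0 ∧ x.pb = 0 := by
    intro x
    rw [RingHom.mem_ker]
    exact Prod.ext_iff
  refine bdd_zero (RingHom.ker (toD π)) ?_ ?_ ?_
  · obtain ⟨n, hn⟩ := hnil
    have h1 : ∀ n, ∀ x ∈ RingHom.ker (toD π) ^ n, x.pa ∈ RingHom.ker π ^ n := by
      intro n
      induction n with
      | zero => intro x _; rw [Submodule.pow_zero, Ideal.one_eq_top]; trivial
      | succ n ih =>
        intro x hx
        rw [Submodule.pow_succ] at hx ⊢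
        refine Submodule.smul_induction_on hx (fun r hr m hm => ?_) (fun x y hx hy => ?_)
        · exact Ideal.mul_mem_mul (ih r hr) ((hmem m).1 hm).1
        · exact Ideal.add_mem _ hx hy
    have h2 : ∀ x ∈ RingHom.ker (toD π) ^ (n + 1), x.pa = 0 ∧ x.pb = 0 := by
      intro x hx
      have hx' : x ∈ RingHom.ker (toD π) := by
        have e : RingHom.ker (toD π) ^ (n + 1) = RingHom.ker (toD π) ^ n * RingHom.ker (toD π) :=
          Submodule.pow_succ _
        have e2 : RingHom.ker (toD π) ^ n * RingHom.ker (toD π) ≤ RingHom.ker (toD π) :=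
          Submodule.smul_le_right
        exact e2 (e ▸ hx)
      have := h1 (n+1) x hx
      have e3 : RingHom.ker π ^ (n + 1) = ⊥ := by
        rw [Submodule.pow_succ, hn, Ideal.zero_eq_bot, Ideal.bot_mul]
      rw [e3] at this
      exact ⟨(Submodule.mem_bot A).1 this, ((hmem x).1 hx').2⟩
    refine ⟨(n + 1) + (n + 1), ?_⟩
    rw [Submodule.pow_add _ (Nat.succ_ne_zero n), Ideal.zero_eq_bot, eq_bot_iff]
    intro x hx
    refine Submodule.smul_induction_on hx (fun r hr m hm => ?_) (fun x y hx hy => ?_)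
    · obtain ⟨a1, a2⟩ := h2 r hr
      obtain ⟨b1, b2⟩ := h2 m hm
      rw [Submodule.mem_bot]
      apply ext' <;> simp [a1, a2, b1, b2]
    · exact Ideal.add_mem _ hx hy
  · have hs : Function.Surjective (toD π) := by
      rintro ⟨q, b⟩
      obtain ⟨a, rfl⟩ := hπ q
      exact ⟨mk a 0 b 0, rfl⟩
    exact (RingHom.quotientKerEquivOfSurjective hs).symm.isSemisimpleRing
  · intro a ha
    rw [hmem]
    constructor
    · have := ha (mk 0 1 0 0) (fun j hj => by
        obtain ⟨h1, h2⟩ := (hmem j).1 hj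
        apply ext' <;> simp [h1])
      simpa using congrArg pm this
    · have := ha (mk 0 0 0 1) (fun j hj => by
        obtain ⟨h1, h2⟩ := (hmem j).1 hj
        apply ext' <;> simp [h2])
      simpa using congrArg pc this

theorem proj_op : letI := Module.compHom Aᵐᵒᵖ (RingHom.op (toA π))
    Module.Projective (UAlg π)ᵐᵒᵖ Aᵐᵒᵖ := by
  letI := Module.compHom Aᵐᵒᵖ (RingHom.op (toA π))
  let s : Aᵐᵒᵖ →ₗ[(UAlg π)ᵐᵒᵖ] (UAlg π)ᵐᵒᵖ :=
    { toFun := fun a => MulOpposite.op (mk a.unop 0 0 0)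
      map_add' := fun x y => by
        apply MulOpposite.unop_injective
        apply ext' <;> simp
      map_smul' := fun x y => by
        apply MulOpposite.unop_injective
        apply ext' <;> simp
        rfl }
  let t : (UAlg π)ᵐᵒᵖ →ₗ[(UAlg π)ᵐᵒᵖ] Aᵐᵒᵖ :=
    { toFun := RingHom.op (toA π)
      map_add' := map_add _
      map_smul' := fun x y => map_mul (RingHom.op (toA π)) x y }
  exact Module.Projective.of_split s t (LinearMap.ext fun x => rfl)

end UAlg
end construction

/-- **Theorem (big finitistic dimension conjecture ⟺ left-right symmetry).**
The big finitistic dimension conjecture holds for all finite dimensional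
algebras if and only if, for all finite dimensional algebras `Λ`,
`FinDim Λ < ∞` implies `FinDim Λᵒᵖ < ∞`. -/
theorem FinDim_conjecture_iff_left_right_symmetric :
    (∀ (k Λ : Type u) [Field k] [Ring Λ] [Algebra k Λ] [FiniteDimensional k Λ],
      FinDim Λ < ⊤) ↔
    (∀ (k Λ : Type u) [Field k] [Ring Λ] [Algebra k Λ] [FiniteDimensional k Λ],
      FinDim Λ < ⊤ → FinDim Λᵐᵒᵖ < ⊤) := by
  constructor
  · intro h k Λ _ _ _ _ _
    exact h k Λᵐᵒᵖ
  · intro h k A _ _ _ _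
    haveI : IsArtinianRing A := IsArtinianRing.of_finite k A
    let π : A →ₐ[k] (A ⧸ Ring.jacobson A) := Ideal.Quotient.mkₐ k (Ring.jacobson A)
    have hπ : Function.Surjective π := Ideal.Quotient.mkₐ_surjective k _
    have hker : RingHom.ker π = Ring.jacobson A := Ideal.Quotient.mkₐ_ker k _
    haveI : FiniteDimensional k (A ⧸ Ring.jacobson A) :=
      Module.Finite.of_surjective π.toLinearMap hπ
    have hb : BddPD (UAlg π) 0 := UAlg.bdd π hπ inferInstance
      (by rw [hker]; exact IsSemiprimaryRing.isNilpotent)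
    have h1 : FinDim (UAlg π)ᵐᵒᵖ < ⊤ :=
      (FinDim_lt_top_iff _).2 ⟨0, bdd_equiv (RingEquiv.opOp _) 0 hb⟩
    have h2 := h k (UAlg π)ᵐᵒᵖ h1
    obtain ⟨d, hd⟩ := (FinDim_lt_top_iff _).1 h2
    rw [FinDim_lt_top_iff]
    refine ⟨d, bdd_transfer (RingHom.op (UAlg.toA π)) ?_ (UAlg.proj_op π) d
      (bdd_equiv (RingEquiv.opOp (UAlg π)ᵐᵒᵖ).symm d hd)⟩
    intro a
    exact ⟨MulOpposite.op (UAlg.mk a.unop 0 0 0), rfl⟩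
end

section
/- With à the trivial square-zero extension algebra constructed from the basic finite dimensional algebra A, the little finitistic dimension of A is at most that of Ã: findim A ≤ findim Ã. -/
open TrivSqZeroExt MulOpposite

universe u

section Construction

variable (k : Type u) [Field k] (n : ℕ) (A : Type u) [Ring A] [Algebra k A]

/-- The algebra `B`, a product of `n` copies of the dual numbers `k[ℓ]/(ℓ²)`. -/
abbrev ConstrB : Type u := Fin n → DualNumber k

/-- The projection `B → (Fin n → k)` killing the radical of each dual-number factor. -/
noncomputable def constrBproj : ConstrB k n →ₐ[k] (Fin n → k) :=
  Pi.algHom k (fun _ => k) fun i => (TrivSqZeroExt.fstHom k k k).comp (Pi.evalAlgHom k _ i)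

/-- The left `(A × B)`-module structure on `M = A/rad A ≅ Fin n → k`:
`(a, b)` acts on the left through the projection `B → Fin n → k`. -/
noncomputable def constrLeftModule : Module (A × ConstrB k n) (Fin n → k) :=
  Module.compHom _ ((constrBproj k n).comp (AlgHom.snd k A (ConstrB k n))).toRingHom

variable (π : A →ₐ[k] (Fin n → k))

/-- The right `(A × B)`-module structure on `M = A/rad A ≅ Fin n → k`:
`(a, b)` acts on the right through `π : A → A/rad A ≅ Fin n → k`. -/
noncomputable def constrRightModule : Module (A × ConstrB k n)ᵐᵒᵖ (Fin n → k) :=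
  Module.compHom _ ((π.toRingHom.comp (RingHom.fst A (ConstrB k n))).fromOpposite
    fun _ _ => Commute.all _ _)

/-- The two actions on `M` commute. -/
noncomputable def constrSMulCommClass :
    letI := constrLeftModule k n A
    letI := constrRightModule k n A π
    SMulCommClass (A × ConstrB k n) (A × ConstrB k n)ᵐᵒᵖ (Fin n → k) :=
  letI := constrLeftModule k n A
  letI := constrRightModule k n A π
  ⟨fun _ _ _ => mul_left_comm _ _ _⟩

end Construction


section Helpers

open CategoryTheory

theorem ses_iff_aux (R : Type u) [Ring R] {K P X : Type u} [AddCommGroup K] [Module R K]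
    [AddCommGroup P] [Module R P] [AddCommGroup X] [Module R X]
    (i : K →ₗ[R] P) (f : P →ₗ[R] X) (hi : Function.Injective i) (hf : Function.Surjective f)
    (hex : Function.Exact i f) (hP : Module.Projective R P) (m : ℕ) :
    HasProjectiveDimensionLT (ModuleCat.of R X) (m + 2) ↔
      HasProjectiveDimensionLT (ModuleCat.of R K) (m + 1) := by
  let S : ShortComplex (ModuleCat.{u} R) :=
    ShortComplex.mk (ModuleCat.ofHom i) (ModuleCat.ofHom f) (by
      ext x; exact hex.apply_apply_eq_zero x)
  have hS : S.ShortExact :=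
    { exact := (ShortComplex.ShortExact.moduleCat_exact_iff_function_exact S).mpr hex
      mono_f := (ModuleCat.mono_iff_injective _).mpr hi
      epi_g := (ModuleCat.epi_iff_surjective _).mpr hf }
  exact hS.hasProjectiveDimensionLT_X₃_iff m ((IsProjective.iff_projective P).mp hP)

theorem projDimLE_iff_aux (R : Type u) [Ring R] (m : ℕ) : ∀ (M : Type u) [AddCommGroup M]
    [Module R M], ProjDimLE R m M ↔ HasProjectiveDimensionLT (ModuleCat.of R M) (m + 1) := by
  induction m with
  | zero =>
    intro M _ _
    rw [ProjDimLE, zero_add, ← projective_iff_hasProjectiveDimensionLT_one]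
    exact IsProjective.iff_projective M
  | succ m ih =>
    intro M _ _
    rw [ProjDimLE]
    constructor
    · rintro ⟨P, _, _, f, hP, hf, hK⟩
      rw [ih] at hK
      exact (ses_iff_aux R (LinearMap.ker f).subtype f Subtype.val_injective hf
        (LinearMap.exact_subtype_ker_map f) hP m).mpr hK
    · intro h
      refine ⟨M →₀ R, inferInstance, inferInstance, Finsupp.linearCombination R id,
        inferInstance, Finsupp.linearCombination_id_surjective R M, ?_⟩
      rw [ih]
      exact (ses_iff_aux R (LinearMap.ker (Finsupp.linearCombination R (id : M → M))).subtype _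
        Subtype.val_injective (Finsupp.linearCombination_id_surjective R M)
        (LinearMap.exact_subtype_ker_map _) inferInstance m).mp h

theorem projDimLE_ses (R : Type u) [Ring R] {K P X : Type u} [AddCommGroup K] [Module R K]
    [AddCommGroup P] [Module R P] [AddCommGroup X] [Module R X]
    (i : K →ₗ[R] P) (f : P →ₗ[R] X) (hi : Function.Injective i) (hf : Function.Surjective f)
    (hex : Function.Exact i f) (hP : Module.Projective R P) (m : ℕ) :
    ProjDimLE R (m + 1) X ↔ ProjDimLE R m K := by
  rw [projDimLE_iff_aux, projDimLE_iff_aux]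
  exact ses_iff_aux R i f hi hf hex hP m

/-- an `R`-linear map is `S`-linear when `S` acts through `q`. -/
def resLin {R S : Type u} [Ring R] [Ring S] (q : S →+* R) {X Y : Type u}
    [AddCommGroup X] [Module R X] [Module S X] [AddCommGroup Y] [Module R Y] [Module S Y]
    (hX : ∀ (s : S) (x : X), s • x = q s • x) (hY : ∀ (s : S) (x : Y), s • x = q s • x)
    (f : X →ₗ[R] Y) : X →ₗ[S] Y where
  toFun := f
  map_add' := f.map_add
  map_smul' s x := by simp [hX, hY]

theorem proj_finsupp_aux {R S : Type u} [Ring R] [Ring S] (q : S →+* R) (j : R →+ S)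
    (hqj : ∀ r, q (j r) = r) (hj : ∀ s r, j (q s * r) = s * j r)
    (ι : Type u) [Module S (ι →₀ R)] (h : ∀ (s : S) (x : ι →₀ R), s • x = q s • x) :
    Module.Projective S (ι →₀ R) := by
  let i : (ι →₀ R) →ₗ[S] (ι →₀ S) :=
    { toFun := Finsupp.mapRange j (map_zero j)
      map_add' := fun x y => by ext; simp
      map_smul' := fun s x => by ext; simp [h, hj] }
  let p : (ι →₀ S) →ₗ[S] (ι →₀ R) :=
    { toFun := Finsupp.mapRange q (map_zero q)
      map_add' := fun x y => by ext; simp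
      map_smul' := fun s x => by ext; simp [h] }
  refine Module.Projective.of_split i p ?_
  ext1 x
  ext a
  simp [i, p, hqj]

theorem projective_iff_aux {R S : Type u} [Ring R] [Ring S] (q : S →+* R) (j : R →+ S)
    (hqj : ∀ r, q (j r) = r) (hj : ∀ s r, j (q s * r) = s * j r)
    (X : Type u) [AddCommGroup X] [Module R X] [Module S X]
    (h : ∀ (s : S) (x : X), s • x = q s • x) :
    Module.Projective S X ↔ Module.Projective R X := by
  letI : Module S (X →₀ R) := Module.compHom _ q
  have hF : ∀ (s : S) (x : X →₀ R), s • x = q s • x := fun _ _ => rfl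
  have hpF := proj_finsupp_aux q j hqj hj X hF
  constructor
  · intro hX
    obtain ⟨g, hg⟩ := Module.projective_lifting_property
      (resLin q hF h (Finsupp.linearCombination R (id : X → X))) LinearMap.id
      (Finsupp.linearCombination_id_surjective R X)
    let g' : X →ₗ[R] (X →₀ R) :=
      { toFun := g
        map_add' := g.map_add
        map_smul' := fun r x => by
          have := g.map_smul (j r) x
          rw [h, hF, hqj] at this
          exact this }
    refine Module.Projective.of_split g' (Finsupp.linearCombination R (id : X → X)) ?_
    ext x
    exact LinearMap.congr_fun hg x
  · intro hX
    obtain ⟨g, hg⟩ := Module.projective_lifting_property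
      (Finsupp.linearCombination R (id : X → X)) LinearMap.id
      (Finsupp.linearCombination_id_surjective R X)
    refine Module.Projective.of_split (resLin q h hF g)
      (resLin q hF h (Finsupp.linearCombination R (id : X → X))) ?_
    ext x
    exact LinearMap.congr_fun hg x

theorem projDimLE_res {R S : Type u} [Ring R] [Ring S] (q : S →+* R) (j : R →+ S)
    (hqj : ∀ r, q (j r) = r) (hj : ∀ s r, j (q s * r) = s * j r) (m : ℕ) :
    ∀ (X : Type u) [AddCommGroup X] [Module R X] [Module S X]
    (_ : ∀ (s : S) (x : X), s • x = q s • x), ProjDimLE S m X ↔ ProjDimLE R m X := by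
  induction m with
  | zero => intro X _ _ _ h; exact projective_iff_aux q j hqj hj X h
  | succ m ih =>
    intro X _ _ _ h
    letI : Module S (X →₀ R) := Module.compHom _ q
    have hF : ∀ (s : S) (x : X →₀ R), s • x = q s • x := fun _ _ => rfl
    have hpF := proj_finsupp_aux q j hqj hj X hF
    let f := Finsupp.linearCombination R (id : X → X)
    have hf : Function.Surjective f := Finsupp.linearCombination_id_surjective R X
    obtain ⟨K, _, _, i, hi, hex⟩ : ∃ (K : Type u) (_ : AddCommGroup K) (_ : Module R K)
        (i : K →ₗ[R] (X →₀ R)), Function.Injective i ∧ Function.Exact i f :=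
      ⟨LinearMap.ker f, inferInstance, inferInstance, (LinearMap.ker f).subtype,
        Subtype.val_injective, LinearMap.exact_subtype_ker_map f⟩
    letI : Module S K := Module.compHom _ q
    have hK : ∀ (s : S) (x : K), s • x = q s • x := fun _ _ => rfl
    rw [projDimLE_ses R i f hi hf hex inferInstance m,
      projDimLE_ses S (resLin q hK hF i) (resLin q hF h f) hi hf hex hpF m]
    exact ih _ hK

theorem findim_le_aux {A T : Type u} [Ring A] [Ring T] (q : T →+* A) (j : A →+ T)
    (hqj : ∀ r, q (j r) = r) (hj : ∀ s r, j (r * q s) = j r * s) : findim A ≤ findim T := by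
  refine sSup_le_sSup ?_
  rintro d ⟨M, _, _, hfin, hd, hd'⟩
  letI : Module Tᵐᵒᵖ M := Module.compHom M q.op
  have h : ∀ (s : Tᵐᵒᵖ) (x : M), s • x = q.op s • x := fun _ _ => rfl
  refine ⟨M, inferInstance, inferInstance, ?_, ?_, hd'⟩
  · obtain ⟨t, ht⟩ := hfin.fg_top
    refine ⟨t, ?_⟩
    rw [eq_top_iff]
    intro x _
    have hx : x ∈ Submodule.span Aᵐᵒᵖ (t : Set M) := by rw [ht]; trivial
    induction hx using Submodule.span_induction with
    | mem x hx => exact Submodule.subset_span hx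
    | zero => exact Submodule.zero_mem _
    | add x y _ _ h1 h2 => exact Submodule.add_mem _ (h1 trivial) (h2 trivial)
    | smul a x _ h1 =>
      have := Submodule.smul_mem _ (op (j a.unop)) (h1 trivial)
      rw [h] at this
      simpa [hqj] using this
  · rw [← hd]
    unfold projDim
    congr 2
    ext m
    refine projDimLE_res q.op (AddMonoidHom.mulOp j) ?_ ?_ m M h
    · intro r; simp [hqj]
    · intro s r
      apply unop_injective
      exact hj s.unop r.unop

end Helpers

/-- **Theorem.** Let `A` be a basic finite dimensional algebra over an algebraically
closed field `k`, with exactly `n` isomorphism classes of simple right `A`-modules;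
this is encoded by a surjective `k`-algebra homomorphism `π : A → (Fin n → k)` whose
kernel is the Jacobson radical of `A`.  Let `Ã` be the trivial square-zero extension
of `A × B` (where `B` is a product of `n` copies of the dual numbers) by the
bimodule `M = A/rad A ≅ (Fin n → k)`.  Then `findim A ≤ findim Ã`. -/
theorem findim_le_findim_constr
    (k : Type u) [Field k] [IsAlgClosed k] (n : ℕ)
    (A : Type u) [Ring A] [Algebra k A] [FiniteDimensional k A]
    (π : A →ₐ[k] (Fin n → k)) (hsurj : Function.Surjective π)
    (hker : RingHom.ker π = Ideal.jacobson (⊥ : Ideal A)) :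
    letI := constrLeftModule k n A
    letI := constrRightModule k n A π
    letI := constrSMulCommClass k n A π
    findim A ≤ findim (TrivSqZeroExt (A × ConstrB k n) (Fin n → k)) := by
  letI := constrLeftModule k n A
  letI := constrRightModule k n A π
  letI := constrSMulCommClass k n A π
  have key : ∀ (a : A) (v : Fin n → k), ((a, 0) : A × ConstrB k n) • v = 0 := by
    intro a v
    change (constrBproj k n) (0 : ConstrB k n) * v = 0
    rw [map_zero, zero_mul]
  let q : TrivSqZeroExt (A × ConstrB k n) (Fin n → k) →+* A :=
    { toFun := fun x => x.fst.1
      map_one' := rfl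
      map_mul' := fun _ _ => rfl
      map_zero' := rfl
      map_add' := fun _ _ => rfl }
  let j : A →+ TrivSqZeroExt (A × ConstrB k n) (Fin n → k) :=
    { toFun := fun a => inl (a, 0)
      map_zero' := rfl
      map_add' := fun a b => by ext1 <;> simp }
  refine findim_le_aux q j (fun _ => rfl) ?_
  intro s r
  change inl (r * s.fst.1, 0) = inl (r, 0) * s
  ext1
  · rw [fst_mul, fst_inl, fst_inl]
    ext1
    · rfl
    · exact (zero_mul _).symm
  · rw [snd_mul, snd_inl, fst_inl, snd_inl, key, smul_zero, add_zero]
end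

section
/- With à the trivial square-zero extension algebra constructed from the basic finite dimensional algebra A, the big finitistic dimension of A is at most that of Ã: FinDim A ≤ FinDim Ã. -/
open TrivSqZeroExt MulOpposite

universe u

section Aux

open CategoryTheory

variable {R S : Type u} [Ring R] [Ring S] (q : R →+* S) (σ : S →+ R)

theorem aux_proj (hσ : ∀ s, q (σ s) = s) (hmul : ∀ r s, σ (q r * s) = r * σ s)
    (M : Type u) [AddCommGroup M] [Module R M] [Module S M]
    (hM : ∀ (r : R) (m : M), r • m = q r • m) :
    Module.Projective S M ↔ Module.Projective R M := by
  rw [Module.projective_def, Module.projective_def]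
  constructor
  · rintro ⟨s, hs⟩
    refine ⟨{ toFun := fun m => (s m).mapRange σ (map_zero σ)
              map_add' := fun x y => by
                ext i; simp
              map_smul' := fun r x => by
                ext i; simp [hM, hmul] }, fun m => ?_⟩
    have h := hs m
    simp only [Finsupp.linearCombination_apply] at h ⊢
    simp only [LinearMap.coe_mk, AddHom.coe_mk]
    rw [Finsupp.sum_mapRange_index (by simp)]
    simpa [hM, hσ] using h
  · rintro ⟨s, hs⟩
    refine ⟨{ toFun := fun m => (s m).mapRange q (map_zero q)
              map_add' := fun x y => by
                ext i; simp
              map_smul' := fun r x => by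
                ext i
                rw [← hσ r, ← hM]
                simp }, fun m => ?_⟩
    have h := hs m
    simp only [Finsupp.linearCombination_apply] at h ⊢
    simp only [LinearMap.coe_mk, AddHom.coe_mk]
    rw [Finsupp.sum_mapRange_index (by simp)]
    simpa [hM] using h

theorem aux_shift (n : ℕ) (M P : Type u) [AddCommGroup M] [Module R M] [AddCommGroup P]
    [Module R P] [Module.Projective R P] (f : P →ₗ[R] M) (hf : Function.Surjective f) :
    HasProjectiveDimensionLE (ModuleCat.of R M) (n+1) ↔
      HasProjectiveDimensionLE (ModuleCat.of R (LinearMap.ker f)) n := by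
  have hS := LinearMap.shortExact_shortComplexKer hf
  have hP : Projective (ModuleCat.of R P) := (IsProjective.iff_projective P).1 inferInstance
  exact hS.hasProjectiveDimensionLT_X₃_iff n hP

theorem aux_dim (hσ : ∀ s, q (σ s) = s) (hmul : ∀ r s, σ (q r * s) = r * σ s) (n : ℕ) :
    ∀ (M : Type u) [AddCommGroup M] [Module R M] [Module S M]
    (_ : ∀ (r : R) (m : M), r • m = q r • m),
    ProjDimLE S n M ↔ HasProjectiveDimensionLE (ModuleCat.of R M) n := by
  induction n with
  | zero =>
    intro M _ _ _ hM
    rw [← projective_iff_hasProjectiveDimensionLE_zero, ← IsProjective.iff_projective]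
    exact aux_proj q σ hσ hmul M hM
  | succ n ih =>
    intro M _ _ _ hM
    have key : ∀ (P : Type u) [AddCommGroup P] [Module S P] (f : P →ₗ[S] M),
        Module.Projective S P → Function.Surjective f →
        (HasProjectiveDimensionLE (ModuleCat.of R M) (n+1) ↔
          ProjDimLE S n (LinearMap.ker f)) := by
      intro P _ _ f hP hf
      letI : Module R P := Module.compHom P q
      have hPP : ∀ (r : R) (m : P), r • m = q r • m := fun _ _ => rfl
      have : Module.Projective R P := (aux_proj q σ hσ hmul P hPP).1 hP
      let f' : P →ₗ[R] M :=
        { toFun := f, map_add' := map_add f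
          map_smul' := fun r x => by simp [hPP, hM] }
      rw [aux_shift n M P f' hf]
      letI : Module R (LinearMap.ker f) := Module.compHom _ q
      exact (ih (LinearMap.ker f) (fun r m => rfl)).symm
    constructor
    · rintro ⟨P, _, _, f, hP, hf, h⟩
      exact (key P f hP hf).2 h
    · intro h
      have hs : Function.Surjective (Finsupp.linearCombination S (id : M → M)) :=
        fun x ↦ ⟨Finsupp.single x 1, by simp⟩
      exact ⟨M →₀ S, inferInstance, inferInstance, Finsupp.linearCombination S id,
        inferInstance, hs, (key _ _ inferInstance hs).1 h⟩

theorem aux_projDim (hσ : ∀ s, q (σ s) = s) (hmul : ∀ r s, σ (q r * s) = r * σ s)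
    (M : Type u) [AddCommGroup M] [Module R M] [Module S M]
    (hM : ∀ (r : R) (m : M), r • m = q r • m) : projDim S M = projDim R M := by
  unfold projDim
  congr 2
  ext n
  exact (aux_dim q σ hσ hmul n M hM).trans
    (aux_dim (RingHom.id R) (AddMonoidHom.id R) (fun _ => rfl) (fun _ _ => rfl) n M
      (fun _ _ => rfl)).symm

end Aux

/-- **Theorem.** Let `A` be a basic finite dimensional algebra over an algebraically
closed field `k`, with exactly `n` isomorphism classes of simple right `A`-modules;
this is encoded by a surjective `k`-algebra homomorphism `π : A → (Fin n → k)` whose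
kernel is the Jacobson radical of `A`.  Let `Ã` be the trivial square-zero extension
of `A × B` (where `B` is a product of `n` copies of the dual numbers) by the
bimodule `M = A/rad A ≅ (Fin n → k)`.  Then `FinDim A ≤ FinDim Ã`. -/
theorem FinDim_le_FinDim_constr
    (k : Type u) [Field k] [IsAlgClosed k] (n : ℕ)
    (A : Type u) [Ring A] [Algebra k A] [FiniteDimensional k A]
    (π : A →ₐ[k] (Fin n → k)) (hsurj : Function.Surjective π)
    (hker : RingHom.ker π = Ideal.jacobson (⊥ : Ideal A)) :
    letI := constrLeftModule k n A
    letI := constrRightModule k n A π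
    letI := constrSMulCommClass k n A π
    FinDim A ≤ FinDim (TrivSqZeroExt (A × ConstrB k n) (Fin n → k)) := by
  letI := constrLeftModule k n A
  letI := constrRightModule k n A π
  letI := constrSMulCommClass k n A π
  let q₀ : TrivSqZeroExt (A × ConstrB k n) (Fin n → k) →+* A :=
    { toFun := fun x => x.fst.1
      map_one' := rfl
      map_mul' := fun _ _ => rfl
      map_zero' := rfl
      map_add' := fun _ _ => rfl }
  let σ : Aᵐᵒᵖ →+ (TrivSqZeroExt (A × ConstrB k n) (Fin n → k))ᵐᵒᵖ :=
    { toFun := fun a => op (TrivSqZeroExt.inl (a.unop, 0))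
      map_zero' := rfl
      map_add' := fun a b => by
        apply MulOpposite.unop_injective
        ext <;> simp }
  have hs : ∀ (a : A) (m : Fin n → k), ((a, 0) : A × ConstrB k n) • m = 0 := by
    intro a m
    change ((constrBproj k n).comp (AlgHom.snd k A (ConstrB k n))) (a, 0) * m = 0
    simp
  apply sSup_le_sSup
  rintro d ⟨M, _, _, hd, hd'⟩
  letI : Module (TrivSqZeroExt (A × ConstrB k n) (Fin n → k))ᵐᵒᵖ M :=
    Module.compHom M (RingHom.op q₀)
  refine ⟨M, inferInstance, inferInstance, ?_, hd'⟩
  rw [← hd]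
  refine (aux_projDim (RingHom.op q₀) σ (fun _ => rfl) ?_ M (fun _ _ => rfl)).symm
  intro r s
  apply MulOpposite.unop_injective
  apply TrivSqZeroExt.ext
  · change ((s.unop * r.unop.fst.1, 0) : A × ConstrB k n) = (s.unop, 0) * r.unop.fst
    ext <;> simp
  · change (0 : Fin n → k) = ((s.unop, 0) : A × ConstrB k n) • r.unop.snd
      + MulOpposite.op r.unop.fst • (0 : Fin n → k)
    rw [hs, smul_zero, add_zero]
end

section
/- With à the trivial square-zero extension algebra constructed from the basic finite dimensional algebra A, both finitistic dimensions of the opposite algebra of à vanish: findim Ãᵒᵖ = 0 and FinDim Ãᵒᵖ = 0. -/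
open TrivSqZeroExt MulOpposite

universe u

section Aux

theorem aux_semisimple {T : Type*} [Ring T] [IsSemiprimaryRing T] (P : Type*) [AddCommGroup P]
    [Module T P] : IsSemisimpleModule T (P ⧸ (Ring.jacobson T • (⊤ : Submodule T P))) := by
  have h : Module.IsTorsionBySet T (P ⧸ (Ring.jacobson T • (⊤ : Submodule T P)))
      (Ring.jacobson T) := by
    rw [Module.isTorsionBySet_quotient_iff]
    exact fun m i hi ↦ Submodule.smul_mem_smul hi trivial
  let _ := h.module
  exact (h.semilinearMap.isSemisimpleModule_iff_of_bijective Function.bijective_id).2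
      inferInstance

theorem aux_mem {T : Type*} [Ring T] (s : T) (hs : ∀ r, s * r = 0 → r ∈ Ring.jacobson T)
    (P : Type*) [AddCommGroup P] [Module T P] [Module.Projective T P] (x : P) (hx : s • x = 0) :
    x ∈ Ring.jacobson T • (⊤ : Submodule T P) := by
  obtain ⟨f, hf⟩ := Module.Projective.out (R := T) (P := P)
  have h1 : s • f x = 0 := by rw [← map_smul, hx, map_zero]
  rw [← hf x, Finsupp.linearCombination_apply]
  refine Submodule.sum_mem _ fun i _ => Submodule.smul_mem_smul (hs _ ?_) trivial
  have := DFunLike.congr_fun h1 i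
  simpa using this

theorem aux_kill {T : Type*} [Ring T] (s : T) (hs : ∀ r ∈ Ring.jacobson T, s * r = 0)
    (P : Type*) [AddCommGroup P] [Module T P] (x : P)
    (hx : x ∈ Ring.jacobson T • (⊤ : Submodule T P)) : s • x = 0 := by
  refine Submodule.smul_induction_on hx (fun r hr m _ => ?_) (fun x y h1 h2 => ?_)
  · rw [smul_smul, hs r hr, zero_smul]
  · rw [smul_add, h1, h2, add_zero]

theorem aux_nilp {T : Type*} [Ring T] [IsSemiprimaryRing T] (P : Type*) [AddCommGroup P]
    [Module T P] (h : P →ₗ[T] P)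
    (hh : ∀ x, h x ∈ Ring.jacobson T • (⊤ : Submodule T P)) : IsNilpotent h := by
  obtain ⟨m, hm⟩ := IsSemiprimaryRing.isNilpotent (R := T)
  have key : ∀ j : ℕ, ∀ x, (h ^ j) x ∈ (Ring.jacobson T ^ j) • (⊤ : Submodule T P) := by
    intro j
    induction j with
    | zero => intro x; rw [Submodule.pow_zero, Ideal.one_eq_top, Submodule.top_smul]; trivial
    | succ j ih =>
      intro x
      rw [pow_succ, Module.End.mul_apply]
      refine Submodule.smul_induction_on (p := fun y => (h ^ j) y ∈ _) (hh x)
        (fun r hr y _ => ?_) (fun y z h1 h2 => ?_)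
      · rw [map_smul, Ideal.IsTwoSided.pow_succ, Submodule.mul_smul]
        exact Submodule.smul_mem_smul hr (ih y)
      · rw [map_add]; exact add_mem h1 h2
  refine ⟨m, LinearMap.ext fun x => ?_⟩
  have := key m x
  rw [hm] at this
  simpa using this

theorem aux_split {T : Type*} [Ring T] [IsSemiprimaryRing T] (s : T)
    (hs : ∀ r, s * r = 0 ↔ r ∈ Ring.jacobson T)
    (P Q : Type*) [AddCommGroup P] [Module T P] [Module.Projective T P]
    [AddCommGroup Q] [Module T Q] [Module.Projective T Q]
    (i : P →ₗ[T] Q) (hi : Function.Injective i) : ∃ g : Q →ₗ[T] P, g ∘ₗ i = LinearMap.id := by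
  have hmap : Ring.jacobson T • (⊤ : Submodule T P) ≤
      (Ring.jacobson T • (⊤ : Submodule T Q)).comap i := by
    rw [← Submodule.map_le_iff_le_comap, Submodule.map_smul'']
    exact Submodule.smul_mono le_rfl le_top
  let ib := Submodule.mapQ _ _ i hmap
  have hib : Function.Injective ib := by
    rw [injective_iff_map_eq_zero]
    intro x
    obtain ⟨x, rfl⟩ := Submodule.mkQ_surjective _ x
    intro hx
    have hx' : i x ∈ Ring.jacobson T • (⊤ : Submodule T Q) := by
      simpa [ib, Submodule.mapQ_apply] using hx
    have h0 := aux_kill s (fun r hr => (hs r).2 hr) Q _ hx'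
    have h1 : s • x = 0 := hi (by rw [map_smul, h0, map_zero])
    simpa using aux_mem s (fun r hr => (hs r).1 hr) P x h1
  have := aux_semisimple (T := T) Q
  obtain ⟨ρ, hρ⟩ := IsSemisimpleModule.extension_property ib hib LinearMap.id
  obtain ⟨g, hg⟩ := Module.projective_lifting_property
    (Submodule.mkQ (Ring.jacobson T • (⊤ : Submodule T P))) (ρ ∘ₗ Submodule.mkQ _)
    (Submodule.mkQ_surjective _)
  have hnil := aux_nilp (T := T) P (LinearMap.id - g ∘ₗ i) (by
    intro x
    have h1 := LinearMap.congr_fun hg (i x)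
    have h2 := LinearMap.congr_fun hρ (Submodule.mkQ _ x)
    rw [← Submodule.ker_mkQ (Ring.jacobson T • (⊤ : Submodule T P)), LinearMap.mem_ker]
    simp only [LinearMap.sub_apply, LinearMap.id_apply, LinearMap.comp_apply, map_sub] at h1 h2 ⊢
    rw [h1, sub_eq_zero]
    exact h2.symm)
  have hu := hnil.isUnit_one_sub
  obtain ⟨v, hv⟩ := hu.exists_left_inv
  refine ⟨v ∘ₗ g, ?_⟩
  rw [LinearMap.comp_assoc]
  have : (1 - (LinearMap.id - g ∘ₗ i) : Module.End T P) = g ∘ₗ i := by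
    ext x; simp
  rw [this] at hv
  exact hv

theorem aux_proj_s6 {T : Type u} [Ring T] [IsSemiprimaryRing T] (s : T)
    (hs : ∀ r, s * r = 0 ↔ r ∈ Ring.jacobson T) (n : ℕ) :
    ∀ (M : Type u) [AddCommGroup M] [Module T M], ProjDimLE T n M → Module.Projective T M := by
  induction n with
  | zero => intro M _ _ h; exact h
  | succ n ih =>
    intro M _ _ h
    obtain ⟨P, _, _, f, hP, hf, hk⟩ := h
    have := ih _ hk
    obtain ⟨g, hg⟩ := aux_split s hs _ P (LinearMap.ker f).subtype Subtype.val_injective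
    have hex : Function.Exact (LinearMap.ker f).subtype f := LinearMap.exact_subtype_ker_map f
    have := (hex.split_tfae' ).out 1 0
    obtain ⟨_, l, hl⟩ := this.1 ⟨hf, g, hg⟩
    exact Module.Projective.of_split l f hl

theorem aux_dim_s6 {T : Type u} [Ring T] [IsSemiprimaryRing T] (s : T)
    (hs : ∀ r, s * r = 0 ↔ r ∈ Ring.jacobson T)
    (M : Type u) [AddCommGroup M] [Module T M] (h : projDim T M ≠ ⊤) : projDim T M = 0 := by
  have : ∃ n, ProjDimLE T n M := by
    by_contra hc
    push Not at hc
    apply h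
    have : {n : ℕ | ProjDimLE T n M} = ∅ := by ext n; simp [hc n]
    simp [projDim, this]
  obtain ⟨n, hn⟩ := this
  have h0 : ProjDimLE T 0 M := aux_proj_s6 s hs n M hn
  refine le_antisymm (sInf_le ⟨0, h0, rfl⟩) bot_le

theorem aux_jac {T S : Type*} [Ring T] [Ring S] [IsSemisimpleRing S] (φ : T →+* S)
    (hφ : Function.Surjective φ) (hnil : ∀ r, φ r = 0 → IsNilpotent r) (r : T) :
    φ r = 0 ↔ r ∈ Ring.jacobson T := by
  constructor
  · intro h
    rw [← Ideal.jacobson_bot, Ideal.mem_jacobson_iff]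
    intro y
    have h1 := (hnil (y * r) (by rw [map_mul, h, mul_zero])).isUnit_add_one
    obtain ⟨z, hz⟩ := h1.exists_left_inv
    refine ⟨z, ?_⟩
    rw [Ideal.mem_bot, sub_eq_zero, ← hz]
    noncomm_ring
  · intro h
    have : RingHomSurjective φ := ⟨hφ⟩
    have := Ring.le_comap_jacobson φ h
    rw [IsSemisimpleRing.jacobson_eq_bot] at this
    simpa using this

theorem aux_main {R : Type u} [Ring R] {S : Type*} [Ring S] [IsSemisimpleRing S]
    [IsArtinianRing R] (φ : R →+* S)
    (hφ : Function.Surjective φ) (hnil : ∀ r, φ r = 0 → IsNilpotent r) (s : R)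
    (hs : ∀ r, s * r = 0 ↔ φ r = 0) : findim Rᵐᵒᵖ = 0 ∧ FinDim Rᵐᵒᵖ = 0 := by
  let e := RingEquiv.opOp R
  have : IsArtinianRing Rᵐᵒᵖᵐᵒᵖ := e.surjective.isArtinianRing (f := e.toRingHom)
  have hs' : ∀ r, e s * r = 0 ↔ r ∈ Ring.jacobson Rᵐᵒᵖᵐᵒᵖ := by
    intro r
    rw [← aux_jac (φ.comp e.symm.toRingHom) (hφ.comp e.symm.surjective)]
    · obtain ⟨r, rfl⟩ := e.surjective r
      rw [← map_mul, map_eq_zero_iff e e.injective, hs]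
      simp
    · intro r hr
      have := (hnil _ hr).map e
      simpa using this
  constructor
  · refine le_antisymm (sSup_le ?_) bot_le
    rintro d ⟨M, _, _, _, rfl, hd⟩
    exact (aux_dim_s6 (e s) hs' M hd).le
  · refine le_antisymm (sSup_le ?_) bot_le
    rintro d ⟨M, _, _, rfl, hd⟩
    exact (aux_dim_s6 (e s) hs' M hd).le

end Aux

/-- **Theorem.** Let `A` be a basic finite dimensional algebra over an algebraically
closed field `k`, with exactly `n` isomorphism classes of simple right `A`-modules;
this is encoded by a surjective `k`-algebra homomorphism `π : A → (Fin n → k)` whose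
kernel is the Jacobson radical of `A`.  Let `Ã` be the trivial square-zero extension
of `A × B` (where `B` is a product of `n` copies of the dual numbers) by the
bimodule `M = A/rad A ≅ (Fin n → k)`.  Then `findim Ãᵒᵖ = 0` and `FinDim Ãᵒᵖ = 0`. -/
theorem findim_constr_op_eq_zero_and_FinDim_constr_op_eq_zero
    (k : Type u) [Field k] [IsAlgClosed k] (n : ℕ)
    (A : Type u) [Ring A] [Algebra k A] [FiniteDimensional k A]
    (π : A →ₐ[k] (Fin n → k)) (hsurj : Function.Surjective π)
    (hker : RingHom.ker π = Ideal.jacobson (⊥ : Ideal A)) :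
    letI := constrLeftModule k n A
    letI := constrRightModule k n A π
    letI := constrSMulCommClass k n A π
    findim (TrivSqZeroExt (A × ConstrB k n) (Fin n → k))ᵐᵒᵖ = 0 ∧
      FinDim (TrivSqZeroExt (A × ConstrB k n) (Fin n → k))ᵐᵒᵖ = 0 := by
  letI i1 := constrLeftModule k n A
  letI i2 := constrRightModule k n A π
  letI i3 := constrSMulCommClass k n A π
  change findim (TrivSqZeroExt (A × ConstrB k n) (Fin n → k))ᵐᵒᵖ = 0 ∧
      FinDim (TrivSqZeroExt (A × ConstrB k n) (Fin n → k))ᵐᵒᵖ = 0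
  have hl : ∀ (x : A × ConstrB k n) (m : Fin n → k), x • m = constrBproj k n x.2 * m :=
    fun _ _ => rfl
  have hr : ∀ (x : A × ConstrB k n) (m : Fin n → k), op x • m = π x.1 * m :=
    fun _ _ => rfl
  have hp : ∀ (b : ConstrB k n) (j : Fin n), constrBproj k n b j = (b j).fst :=
    fun _ _ => rfl
  have : IsArtinianRing A := IsArtinianRing.of_finite k A
  have : IsArtinianRing (ConstrB k n) := by
    have : IsArtinianRing (DualNumber k) := by
      have : Module.Finite k (DualNumber k) :=
        inferInstanceAs (Module.Finite k (k × k))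
      exact IsArtinianRing.of_finite k _
    infer_instance
  have : IsArtinianRing (A × ConstrB k n) := inferInstance
  have : Module.Finite (A × ConstrB k n) (Fin n → k) := by
    refine Module.Finite.of_surjective
      (LinearMap.toSpanSingleton (A × ConstrB k n) (Fin n → k) 1) fun m => ?_
    refine ⟨(0, fun j => TrivSqZeroExt.inl (m j)), ?_⟩
    rw [LinearMap.toSpanSingleton_apply, hl, mul_one]
    ext j
    rw [hp]
    simp
  have : Module.Finite (A × ConstrB k n) (TrivSqZeroExt (A × ConstrB k n) (Fin n → k)) :=
    inferInstanceAs (Module.Finite (A × ConstrB k n) ((A × ConstrB k n) × (Fin n → k)))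
  have : IsScalarTower (A × ConstrB k n) (TrivSqZeroExt (A × ConstrB k n) (Fin n → k))
      (TrivSqZeroExt (A × ConstrB k n) (Fin n → k)) := by
    refine ⟨fun x y z => ?_⟩
    apply TrivSqZeroExt.ext
    · simp [mul_assoc]
    · simp only [snd_mul, smul_eq_mul, fst_smul, snd_smul, hl, hr, smul_add,
        Prod.snd_mul, map_mul, mul_assoc, mul_add]
      rw [mul_left_comm (π z.fst.1)]
  have : IsArtinianRing (TrivSqZeroExt (A × ConstrB k n) (Fin n → k)) :=
    IsArtinianRing.of_finite (A × ConstrB k n) _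
  let φ : TrivSqZeroExt (A × ConstrB k n) (Fin n → k) →+* (Fin n → k) × (Fin n → k) :=
    { toFun := fun x => (π x.fst.1, constrBproj k n x.fst.2)
      map_one' := by simp
      map_mul' := by intro x y; simp
      map_zero' := by simp
      map_add' := by intro x y; simp }
  have hφ : ∀ x, φ x = 0 ↔ π x.fst.1 = 0 ∧ constrBproj k n x.fst.2 = 0 := fun x => Prod.mk_eq_zero
  refine aux_main φ ?_ ?_
    (TrivSqZeroExt.inl (0, fun _ => DualNumber.eps) + TrivSqZeroExt.inr 1) ?_
  · rintro ⟨x, y⟩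
    obtain ⟨a, rfl⟩ := hsurj x
    refine ⟨TrivSqZeroExt.inl (a, fun j => TrivSqZeroExt.inl (y j)), ?_⟩
    refine Prod.ext rfl ?_
    ext j
    rfl
  · intro r h
    obtain ⟨h1, h2⟩ := (hφ r).1 h
    have ha : IsNilpotent r.fst.1 := by
      have : r.fst.1 ∈ Ring.jacobson A := by
        rw [← Ideal.jacobson_bot, ← hker]
        exact h1
      obtain ⟨m, hm⟩ := IsSemiprimaryRing.isNilpotent (R := A)
      refine ⟨m, ?_⟩
      have h3 := Ideal.pow_mem_pow this m
      rw [hm] at h3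
      simpa using h3
    have hb : IsNilpotent r.fst.2 := by
      refine ⟨2, ?_⟩
      ext j
      · have := congrFun h2 j
        rw [hp] at this
        simp [this]
      · have := congrFun h2 j
        rw [hp] at this
        simp [pow_two, this]
    obtain ⟨p, hpp⟩ := ha
    obtain ⟨q, hq⟩ := hb
    have h4 : (r ^ (p + q)).fst = 0 := by
      rw [fst_pow]
      refine Prod.ext ?_ ?_
      · simp [pow_add, hpp]
      · simp [pow_add, hq]
    refine ⟨(p + q) * 2, ?_⟩
    rw [pow_mul, pow_two]
    apply TrivSqZeroExt.ext
    · rw [fst_mul, h4]; simp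
    · rw [snd_mul, h4]; simp
  · intro r
    rw [hφ]
    have e1 : ((TrivSqZeroExt.inl (0, fun _ => DualNumber.eps) + TrivSqZeroExt.inr 1 :
        TrivSqZeroExt (A × ConstrB k n) (Fin n → k)) * r).snd = π r.fst.1 := by
      simp only [snd_mul, fst_add, snd_add, fst_inl, fst_inr, snd_inl, snd_inr, hr, add_zero,
        zero_add, mul_one, hl]
      ext j
      simp [hp]
    have e2 : ((TrivSqZeroExt.inl (0, fun _ => DualNumber.eps) + TrivSqZeroExt.inr 1 :
        TrivSqZeroExt (A × ConstrB k n) (Fin n → k)) * r).fst =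
        (0, fun j => DualNumber.eps * r.fst.2 j) := by
      simp only [fst_mul, fst_add, fst_inl, fst_inr, add_zero]
      refine Prod.ext ?_ ?_
      · simp
      · rfl
    rw [TrivSqZeroExt.ext_iff, e1, e2, and_comm]
    refine and_congr Iff.rfl ?_
    rw [fst_zero, Prod.mk_eq_zero, funext_iff, funext_iff]
    simp only [hp, true_and, Pi.zero_apply]
    refine forall_congr' fun j => ?_
    rw [TrivSqZeroExt.ext_iff]
    simp [DualNumber.snd_mul]
end

section
/- With à the trivial square-zero extension algebra constructed from the basic finite dimensional algebra A: if injectives generate for Ã, then injectives generate for A. -/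
open TrivSqZeroExt MulOpposite

universe u

open CategoryTheory Limits Pretriangulated

/-- `InjectivesGenerate Λ` : injectives generate for the ring `Λ`, i.e. the smallest
triangulated subcategory of the unbounded derived category of right `Λ`-modules that
contains all the injective modules and is closed under set-indexed coproducts is the
whole derived category.  Subcategories are encoded as sets of objects `S` which are
closed under isomorphism, shifts, extensions (hence are triangulated subcategories)
and coproducts. -/
def InjectivesGenerate (Λ : Type u) [Ring Λ] : Prop :=
  letI : HasDerivedCategory (ModuleCat.{u} Λᵐᵒᵖ) := HasDerivedCategory.standard _
  ∀ S : Set (DerivedCategory (ModuleCat.{u} Λᵐᵒᵖ)),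
    (∀ X Y, (X ≅ Y) → X ∈ S → Y ∈ S) →
    (∀ X ∈ S, ∀ m : ℤ, X⟦m⟧ ∈ S) →
    (∀ T ∈ distinguishedTriangles, T.obj₁ ∈ S → T.obj₃ ∈ S → T.obj₂ ∈ S) →
    (∀ (I : Type u) (f : I → DerivedCategory (ModuleCat.{u} Λᵐᵒᵖ)) (c : Cofan f),
      IsColimit c → (∀ i, f i ∈ S) → c.pt ∈ S) →
    (∀ M : ModuleCat.{u} Λᵐᵒᵖ, Injective M →
      (DerivedCategory.singleFunctor (ModuleCat.{u} Λᵐᵒᵖ) 0).obj M ∈ S) →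
    ∀ X, X ∈ S

section Retract
universe v₁ u₁ v₂ u₂ v₃ u₃
lemma preservesColimit_of_retract_aux {J : Type u₁} [Category.{v₁} J] {C : Type u₂} [Category.{v₂} C]
    {D : Type u₃} [Category.{v₃} D] (H H' : C ⥤ D) (i : H ⟶ H') (r : H' ⟶ H) (hir : i ≫ r = 𝟙 H)
    (K : J ⥤ C) [PreservesColimit K H'] : PreservesColimit K H where
  preserves {c} hc := by
    have hc' := isColimitOfPreserves H' hc
    have hir' : ∀ X, i.app X ≫ r.app X = 𝟙 _ := fun X => by
      rw [← NatTrans.comp_app, hir, NatTrans.id_app]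
    let t (s : Cocone (K ⋙ H)) : Cocone (K ⋙ H') :=
      (Cocone.precompose (Functor.whiskerLeft K r)).obj s
    refine ⟨⟨fun s => i.app c.pt ≫ hc'.desc (t s), fun s j => ?_, fun s m hm => ?_⟩⟩
    · have h := hc'.fac (t s) j
      dsimp [t] at h ⊢
      rw [← Category.assoc, i.naturality, Category.assoc, h, ← Category.assoc, hir',
        Category.id_comp]
    · have : r.app c.pt ≫ m = hc'.desc (t s) := hc'.uniq (t s) _ (fun j => by
        have h := hm j
        dsimp [t] at h ⊢
        rw [← Category.assoc, r.naturality, Category.assoc, h])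
      rw [← this, ← Category.assoc, hir']
      exact (Category.id_comp _).symm
end Retract

section Coextend
variable {R S : Type u} [Ring R] [Ring S] (p : R →+* S) (σ : S →ₙ+* R)

lemma coext_apply (N : ModuleCat.{u} R)
    (g : (ModuleCat.restrictScalars.{u} p).obj (ModuleCat.of S S) →ₗ[R] N) (r : R) :
    g (p r) = r • g (1 : S) :=
  (congrArg g (mul_one (p r))).symm.trans (g.map_smul r (1 : S))

noncomputable def coextToForget : ModuleCat.coextendScalars.{u,u,u} p ⋙ forget₂ (ModuleCat S) AddCommGrpCat ⟶
    forget₂ (ModuleCat.{u} R) AddCommGrpCat where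
  app N := AddCommGrpCat.ofHom
    { toFun := fun g => ModuleCat.CoextendScalars.equiv p N g (1 : S)
      map_zero' := rfl
      map_add' := fun _ _ => rfl }

noncomputable def forgetToCoext (h1 : ∀ r, r * σ 1 = σ (p r)) :
    forget₂ (ModuleCat.{u} R) AddCommGrpCat ⟶
    ModuleCat.coextendScalars.{u,u,u} p ⋙ forget₂ (ModuleCat S) AddCommGrpCat where
  app N := AddCommGrpCat.ofHom
    { toFun := fun n => (ModuleCat.CoextendScalars.equiv p N).symm
        { toFun := fun (s : S) => σ s • (show N from n)
          map_add' := fun (s t : S) => by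
            exact (congrArg (fun z : R => z • (show N from n)) (map_add σ s t)).trans
              (add_smul _ _ _)
          map_smul' := fun (r : R) (s : S) => by
            change σ (p r * s) • (show N from n) = r • (σ s • (show N from n))
            rw [map_mul, ← h1, ← mul_smul, mul_assoc, ← map_mul, one_mul] }
      map_zero' := by
        apply (ModuleCat.CoextendScalars.equiv p N).injective
        ext s
        exact smul_zero _
      map_add' := fun x y => by
        apply (ModuleCat.CoextendScalars.equiv p N).injective
        ext s
        exact smul_add _ _ _ }
  naturality N N' f := by
    ext n
    apply (ModuleCat.CoextendScalars.equiv p N').injective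
    ext s
    exact (f.hom.map_smul (σ s) n).symm

lemma coext_retract (h1 : ∀ r, r * σ 1 = σ (p r)) (h2 : ∀ s, p (σ s) = s) :
    coextToForget p ≫ forgetToCoext p σ h1 = 𝟙 _ := by
  ext N g
  apply (ModuleCat.CoextendScalars.equiv p N).injective
  ext s
  let g' := ModuleCat.CoextendScalars.equiv p N g
  change σ s • g' (1 : S) = g' s
  rw [← coext_apply]
  exact congrArg g' (h2 s)

lemma coext_preservesColimit (h1 : ∀ r, r * σ 1 = σ (p r)) (h2 : ∀ s, p (σ s) = s)
    {J : Type u} [Category.{u} J]  :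
    PreservesColimitsOfShape J (ModuleCat.coextendScalars.{u,u,u} p) := by
  have h3 : PreservesColimitsOfShape J (ModuleCat.coextendScalars.{u,u,u} p ⋙ 
    forget₂ (ModuleCat S) AddCommGrpCat) := ⟨fun {K} => 
    preservesColimit_of_retract_aux _ _ (coextToForget p) _ (coext_retract p σ h1 h2) K⟩
  exact preservesColimitsOfShape_of_reflects_of_preserves _ (forget₂ (ModuleCat S) AddCommGrpCat)

lemma coext_unit (hp : Function.Surjective p) :
    IsIso (ModuleCat.restrictCoextendScalarsAdj.{u,u,u} p).unit := by
  have : ∀ X, IsIso ((ModuleCat.restrictCoextendScalarsAdj.{u,u,u} p).unit.app X) := fun X => by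
    rw [ConcreteCategory.isIso_iff_bijective]
    constructor
    · intro x y h
      have h' := DFunLike.congr_fun (congrArg (ModuleCat.CoextendScalars.equiv p _) h) (1 : S)
      change (1 : S) • x = (1 : S) • y at h'
      simpa using h'
    · intro g
      let g' := ModuleCat.CoextendScalars.equiv p _ g
      refine ⟨g' (1 : S), ?_⟩
      apply (ModuleCat.CoextendScalars.equiv p _).injective
      ext s
      obtain ⟨r, rfl⟩ := hp s
      change r • g' (1 : S) = g' (p r)
      exact (coext_apply p _ g' r).symm
  exact NatIso.isIso_of_isIso_app _
end Coextend

section QCoprod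
universe w w₁ v u'
variable {C : Type u'} [Category.{v} C] [Abelian C] {J : Type w} [HasColimitsOfShape (Discrete J) C]

/-- family of complexes as a complex of families -/
noncomputable def famComplex (X : J → CochainComplex C ℤ) : CochainComplex (Discrete J ⥤ C) ℤ where
  X i := Discrete.functor (fun j => (X j).X i)
  d i i' := Discrete.natTrans (fun j => (X j.as).d i i')
  shape i i' h := by
    ext ⟨j⟩
    exact (X j).shape i i' h
  d_comp_d' i i' i'' _ _ := by
    ext ⟨j⟩
    exact (X j).d_comp_d i i' i''

noncomputable def famMap {X Y : J → CochainComplex C ℤ} (f : ∀ j, X j ⟶ Y j) :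
    famComplex X ⟶ famComplex Y where
  f i := Discrete.natTrans (fun j => (f j.as).f i)
  comm' i i' _ := by
    ext ⟨j⟩
    exact (f j).comm i i'

lemma famMap_quasiIso {X Y : J → CochainComplex C ℤ} (f : ∀ j, X j ⟶ Y j) [∀ j, QuasiIso (f j)] :
    QuasiIso (famMap f) := by
  rw [quasiIso_iff]
  intro i
  rw [quasiIsoAt_iff, ShortComplex.quasiIso_iff, NatTrans.isIso_iff_isIso_app]
  rintro ⟨j⟩
  let φ := (HomologicalComplex.shortComplexFunctor _ (ComplexShape.up ℤ) i).map (famMap f)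
  have γ : ShortComplex.HomologyMapData φ (ShortComplex.homologyData _) (ShortComplex.homologyData _) := default
  have h : ShortComplex.QuasiIso (((evaluation (Discrete J) C).obj ⟨j⟩).mapShortComplex.map φ) := by
    have : QuasiIsoAt (f j) i := inferInstance
    rw [quasiIsoAt_iff] at this
    exact this
  have h := (γ.left.quasiIso_map_iff (F := (evaluation (Discrete J) C).obj ⟨j⟩)).1 h
  have h2 := γ.left.homologyMap_eq
  change IsIso (((evaluation (Discrete J) C).obj ⟨j⟩).map (ShortComplex.homologyMap φ))
  rw [h2]
  rw [Functor.map_comp, Functor.map_comp]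
  infer_instance

noncomputable def sumC (X : J → CochainComplex C ℤ) : CochainComplex C ℤ :=
  ((colim (J := Discrete J) (C := C)).mapHomologicalComplex (ComplexShape.up ℤ)).obj (famComplex X)

noncomputable def sumMap {X Y : J → CochainComplex C ℤ} (f : ∀ j, X j ⟶ Y j) :
    sumC X ⟶ sumC Y :=
  ((colim (J := Discrete J) (C := C)).mapHomologicalComplex (ComplexShape.up ℤ)).map (famMap f)

lemma sumMap_quasiIso [HasExactColimitsOfShape (Discrete J) C]
    {X Y : J → CochainComplex C ℤ} (f : ∀ j, X j ⟶ Y j) [∀ j, QuasiIso (f j)] :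
    QuasiIso (sumMap f) := by
  have := famMap_quasiIso f
  have : PreservesFiniteLimits (colim (J := Discrete J) (C := C)) := inferInstance
  have : PreservesFiniteColimits (colim (J := Discrete J) (C := C)) := inferInstance
  have h : (colim (J := Discrete J) (C := C)).PreservesHomology := Functor.preservesHomologyOfExact _
  exact HomologicalComplex.quasiIso_map_of_preservesHomology _ _

noncomputable def sumι (X : J → CochainComplex C ℤ) (j : J) : X j ⟶ sumC X where
  f i := colimit.ι (Discrete.functor (fun j => (X j).X i)) ⟨j⟩
  comm' i i' _ := by
    dsimp [sumC, famComplex]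
    exact ι_colimMap _ _

noncomputable def sumfDesc (X : J → CochainComplex C ℤ) {i : ℤ} {Z : C} (f : ∀ j, (X j).X i ⟶ Z) :
    (sumC X).X i ⟶ Z :=
  colimit.desc (Discrete.functor (fun j => (X j).X i)) (Cofan.mk Z f)

lemma sumι_f_desc (X : J → CochainComplex C ℤ) {i : ℤ} {Z : C} (f : ∀ j, (X j).X i ⟶ Z) (j : J) :
    (sumι X j).f i ≫ sumfDesc X f = f j :=
  colimit.ι_desc _ _

lemma sumι_f_desc_assoc (X : J → CochainComplex C ℤ) {i : ℤ} {Z : C} (f : ∀ j, (X j).X i ⟶ Z)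
    (j : J) {W : C} (h : Z ⟶ W) :
    (sumι X j).f i ≫ sumfDesc X f ≫ h = f j ≫ h := by
  rw [← Category.assoc, sumι_f_desc]

lemma sumf_ext (X : J → CochainComplex C ℤ) {i : ℤ} {Z : C} (f g : (sumC X).X i ⟶ Z)
    (h : ∀ j, (sumι X j).f i ≫ f = (sumι X j).f i ≫ g) : f = g :=
  colimit.hom_ext (fun ⟨j⟩ => h j)

lemma sumι_map {X Y : J → CochainComplex C ℤ} (f : ∀ j, X j ⟶ Y j) (j : J) :
    sumι X j ≫ sumMap f = f j ≫ sumι Y j := by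
  ext i
  exact ι_colimMap _ _

noncomputable def sumDesc (X : J → CochainComplex C ℤ) {Z : CochainComplex C ℤ} (f : ∀ j, X j ⟶ Z) :
    sumC X ⟶ Z where
  f i := sumfDesc X (fun j => (f j).f i)
  comm' i i' _ := by
    apply sumf_ext
    intro j
    rw [sumι_f_desc_assoc, HomologicalComplex.Hom.comm_assoc, sumι_f_desc,
      HomologicalComplex.Hom.comm]

lemma sumι_desc (X : J → CochainComplex C ℤ) {Z : CochainComplex C ℤ} (f : ∀ j, X j ⟶ Z) (j : J) :
    sumι X j ≫ sumDesc X f = f j := by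
  ext i
  exact sumι_f_desc _ _ _

lemma sum_ext (X : J → CochainComplex C ℤ) {Z : CochainComplex C ℤ} (f g : sumC X ⟶ Z)
    (h : ∀ j, sumι X j ≫ f = sumι X j ≫ g) : f = g := by
  ext i
  apply sumf_ext
  intro j
  exact HomologicalComplex.congr_hom (h j) i

noncomputable def sumIsColimit (X : J → CochainComplex C ℤ) :
    IsColimit (Cofan.mk (sumC X) (sumι X)) :=
  Cofan.IsColimit.mk _ (fun s => sumDesc X s.inj) (fun s j => sumι_desc X _ j)
    (fun s m hm => sum_ext _ _ _ (fun j => by rw [sumι_desc]; exact hm j))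

noncomputable def sumHomotopy (X : J → CochainComplex C ℤ) {Z : CochainComplex C ℤ}
    (g : sumC X ⟶ Z) (h : ∀ j, Homotopy (sumι X j ≫ g) 0) : Homotopy g 0 where
  hom i i' := sumfDesc X (fun j => (h j).hom i i')
  zero i i' hi := sumf_ext _ _ _ (fun j => by rw [sumι_f_desc, (h j).zero _ _ hi, comp_zero])
  comm i := by
    apply sumf_ext
    intro j
    have := (h j).comm i
    rw [HomologicalComplex.comp_f] at this
    rw [this, Preadditive.comp_add, Preadditive.comp_add, ← dNext_comp_left, ← prevD_comp_left]
    simp only [sumι_f_desc]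
    simp

variable [HasDerivedCategory.{w₁} C]
lemma sum_Q_ext [HasExactColimitsOfShape (Discrete J) C] (X : J → CochainComplex C ℤ)
    {Z : CochainComplex C ℤ} (f : DerivedCategory.Q.obj (sumC X) ⟶ DerivedCategory.Q.obj Z)
    (hf : ∀ j, DerivedCategory.Q.map (sumι X j) ≫ f = 0) : f = 0 := by
  obtain ⟨Z', g, s, hs, rfl⟩ := DerivedCategory.left_fac f
  have hg : ∀ j, DerivedCategory.Q.map (sumι X j ≫ g) = 0 := fun j => by
    have := hf j
    rw [← Category.assoc, ← Functor.map_comp] at this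
    simpa using this =≫ DerivedCategory.Q.map s
  have key : ∀ j, ∃ (X' : CochainComplex C ℤ) (t : X' ⟶ X j), QuasiIso t ∧
      Nonempty (Homotopy (t ≫ sumι X j ≫ g) 0) := fun j => by
    have h1 : DerivedCategory.Qh.map ((HomotopyCategory.quotient C (ComplexShape.up ℤ)).map (sumι X j ≫ g)) =
        DerivedCategory.Qh.map ((HomotopyCategory.quotient C (ComplexShape.up ℤ)).map 0) := by
      rw [Functor.map_zero, Functor.map_zero]; exact hg j
    rw [MorphismProperty.map_eq_iff_precomp DerivedCategory.Qh
      (HomotopyCategory.quasiIso C (ComplexShape.up ℤ))] at h1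
    obtain ⟨X', t, ht, e⟩ := h1
    obtain ⟨X', rfl⟩ := HomotopyCategory.quotient_obj_surjective X'
    obtain ⟨t, rfl⟩ := (HomotopyCategory.quotient _ _).map_surjective t
    refine ⟨X', t, ?_, ?_⟩
    · rwa [HomotopyCategory.quotient_map_mem_quasiIso_iff] at ht
    · rw [← Functor.map_comp, ← Functor.map_comp, comp_zero] at e
      exact ⟨HomotopyCategory.homotopyOfEq _ _ e⟩
  choose X' t ht ho using key
  have := sumMap_quasiIso t
  have h0 : DerivedCategory.Q.map (sumMap t ≫ g) = 0 := by
    rw [← Functor.map_zero]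
    apply DerivedCategory.Q_map_eq_of_homotopy
    refine sumHomotopy _ _ (fun j => (Homotopy.ofEq ?_).trans (ho j).some)
    rw [← Category.assoc, sumι_map, Category.assoc]
  rw [Functor.map_comp] at h0
  have : DerivedCategory.Q.map g = 0 := by
    rw [← cancel_epi (DerivedCategory.Q.map (sumMap t)), h0, comp_zero]
  rw [this, zero_comp]

lemma sum_Q_exists [HasExactColimitsOfShape (Discrete J) C] (X : J → CochainComplex C ℤ)
    {Z : CochainComplex C ℤ} (f : ∀ j, DerivedCategory.Q.obj (X j) ⟶ DerivedCategory.Q.obj Z) :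
    ∃ g : DerivedCategory.Q.obj (sumC X) ⟶ DerivedCategory.Q.obj Z,
      ∀ j, DerivedCategory.Q.map (sumι X j) ≫ g = f j := by
  choose X' s hs g hg using fun j => DerivedCategory.right_fac (f j)
  have : ∀ j, QuasiIso (s j) := fun j => (DerivedCategory.isIso_Q_map_iff_quasiIso C _).1 (hs j)
  have := sumMap_quasiIso s
  refine ⟨inv (DerivedCategory.Q.map (sumMap s)) ≫ DerivedCategory.Q.map (sumDesc X' g), fun j => ?_⟩
  rw [hg, ← cancel_epi (DerivedCategory.Q.map (s j)), ← Category.assoc, ← Functor.map_comp,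
    ← sumι_map, Functor.map_comp, Category.assoc, IsIso.hom_inv_id_assoc, IsIso.hom_inv_id_assoc,
    ← Functor.map_comp, sumι_desc]

lemma sum_Q_isColimit [HasExactColimitsOfShape (Discrete J) C] (X : J → CochainComplex C ℤ) :
    Nonempty (IsColimit (DerivedCategory.Q.mapCocone (Cofan.mk (sumC X) (sumι X)))) := by
  have ex : ∀ s : Cocone (Discrete.functor X ⋙ DerivedCategory.Q),
      ∃ g : DerivedCategory.Q.obj (sumC X) ⟶ s.pt,
      ∀ j, DerivedCategory.Q.map (sumι X j) ≫ g = s.ι.app ⟨j⟩ := fun s => by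
    let e := DerivedCategory.Q.objObjPreimageIso s.pt
    obtain ⟨g, hg⟩ := sum_Q_exists X (fun j => s.ι.app ⟨j⟩ ≫ e.inv)
    refine ⟨g ≫ e.hom, fun j => ?_⟩
    rw [← Category.assoc, hg]
    simp
  choose d hd using ex
  refine ⟨⟨d, fun s ⟨j⟩ => hd s j, fun s m hm => ?_⟩⟩
  rw [← sub_eq_zero]
  let e := DerivedCategory.Q.objObjPreimageIso s.pt
  rw [← cancel_mono e.inv, zero_comp]
  apply sum_Q_ext
  intro j
  have h1 : DerivedCategory.Q.map (sumι X j) ≫ m = s.ι.app ⟨j⟩ := hm ⟨j⟩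
  rw [← Category.assoc, Preadditive.comp_sub, hd]
  erw [h1]
  rw [sub_self, zero_comp]

lemma Q_preserves [HasExactColimitsOfShape (Discrete J) C] :
    PreservesColimitsOfShape (Discrete J) (DerivedCategory.Q (C := C)) := ⟨fun {K} => by
  have : PreservesColimit (Discrete.functor (K.obj ∘ Discrete.mk)) (DerivedCategory.Q (C := C)) :=
    preservesColimit_of_preserves_colimit_cocone (sumIsColimit _) (sum_Q_isColimit _).some
  exact preservesColimit_of_iso_diagram _ (Discrete.natIsoFunctor (F := K)).symm⟩
end QCoprod

section mapDer
universe w v u' w₁ w₂ v₂ u₂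
variable {C : Type u'} [Category.{v} C] [Abelian C] {J : Type w} [HasColimitsOfShape (Discrete J) C]
  [HasDerivedCategory.{w₁} C] [HasExactColimitsOfShape (Discrete J) C]
  {D : Type u₂} [Category.{v₂} D] [Abelian D] [HasColimitsOfShape (Discrete J) D]
  [HasDerivedCategory.{w₂} D] [HasExactColimitsOfShape (Discrete J) D]
  (F : C ⥤ D) [F.Additive] [PreservesFiniteLimits F] [PreservesFiniteColimits F]
  [PreservesColimitsOfShape (Discrete J) F]

lemma mapDer_preserves : PreservesColimitsOfShape (Discrete J) F.mapDerivedCategory := ⟨fun {K} => by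
  let X : Discrete J ⥤ CochainComplex C ℤ :=
    Discrete.functor (fun j => DerivedCategory.Q.objPreimage (K.obj ⟨j⟩))
  let e : X ⋙ DerivedCategory.Q ≅ K :=
    Discrete.natIso (fun j => DerivedCategory.Q.objObjPreimageIso (K.obj j))
  have := Q_preserves (C := C) (J := J)
  have := Q_preserves (C := D) (J := J)
  have h1 : PreservesColimitsOfShape (Discrete J) (DerivedCategory.Q ⋙ F.mapDerivedCategory) :=
    preservesColimitsOfShape_of_natIso F.mapDerivedCategoryFactors.symm
  have : PreservesColimit (X ⋙ DerivedCategory.Q) F.mapDerivedCategory := by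
    refine preservesColimit_of_preserves_colimit_cocone
      (isColimitOfPreserves DerivedCategory.Q (colimit.isColimit X)) ?_
    exact isColimitOfPreserves (DerivedCategory.Q ⋙ F.mapDerivedCategory) (colimit.isColimit X)
  exact preservesColimit_of_iso_diagram _ e⟩
end mapDer

section General
variable {Λ' Λ : Type u} [Ring Λ'] [Ring Λ]

lemma coext_general (p : Λ'ᵐᵒᵖ →+* Λᵐᵒᵖ) (σ : Λᵐᵒᵖ →ₙ+* Λ'ᵐᵒᵖ)
    (h1 : ∀ r, r * σ 1 = σ (p r)) (h2 : ∀ s, p (σ s) = s)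
    (H : InjectivesGenerate Λ') : InjectivesGenerate Λ := by
  have hp : Function.Surjective p := fun s => ⟨σ s, h2 s⟩
  letI : HasDerivedCategory (ModuleCat.{u} Λ'ᵐᵒᵖ) := HasDerivedCategory.standard _
  letI : HasDerivedCategory (ModuleCat.{u} Λᵐᵒᵖ) := HasDerivedCategory.standard _
  let G := ModuleCat.restrictScalars.{u} p
  let F := ModuleCat.coextendScalars.{u,u,u} p
  let adj : G ⊣ F := ModuleCat.restrictCoextendScalarsAdj.{u,u,u} p
  have : G.Additive := inferInstanceAs (ModuleCat.restrictScalars.{u} p).Additive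
  have : F.Additive := adj.right_adjoint_additive
  have : G.PreservesMonomorphisms := ⟨fun f hf => by
    rw [ModuleCat.mono_iff_injective] at hf ⊢
    exact hf⟩
  have : PreservesLimitsOfSize.{0, 0} F := adj.rightAdjoint_preservesLimits
  have : PreservesFiniteLimits F := PreservesLimits.preservesFiniteLimits _
  have hF : PreservesColimitsOfSize.{u, u} F :=
    ⟨fun {J} _ => coext_preservesColimit p σ h1 h2⟩
  have : PreservesFiniteColimits F := PreservesColimits.preservesFiniteColimits _
  have hu : IsIso adj.unit := coext_unit p hp
  intro S hiso hshift htri hcop hinj X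
  have key := H {Y | F.mapDerivedCategory.obj Y ∈ S}
    (fun X Y e hX => hiso _ _ (F.mapDerivedCategory.mapIso e) hX)
    (fun X hX m => hiso _ _ ((F.mapDerivedCategory.commShiftIso m).app X).symm (hshift _ hX m))
    (fun T hT h1 h3 => htri _ (F.mapDerivedCategory.map_distinguished T hT) h1 h3)
    (fun I f c hc hf => by
      have := mapDer_preserves (J := I) F
      exact hcop I _ _ (isColimitCofanMkObjOfIsColimit F.mapDerivedCategory f c.inj
        (hc.ofIsoColimit (Cofan.ext (Iso.refl _)))) hf)
    (fun M hM => hiso _ _ ((F.mapDerivedCategorySingleFunctor 0).app M).symm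
      (hinj _ (adj.map_injective M hM)))
  let K := DerivedCategory.Q.objPreimage X
  let K' := (G.mapHomologicalComplex (ComplexShape.up ℤ)).obj K
  let e : (F.mapHomologicalComplex (ComplexShape.up ℤ)).obj K' ≅ K :=
    HomologicalComplex.Hom.isoOfComponents (fun i => ((asIso adj.unit).app (K.X i)).symm)
      (fun i j _ => by
        exact ((asIso adj.unit).inv.naturality (K.d i j)).symm)
  exact hiso _ _ (F.mapDerivedCategoryFactors.app K' ≪≫ DerivedCategory.Q.mapIso e ≪≫
    DerivedCategory.Q.objObjPreimageIso X) (key (DerivedCategory.Q.obj K'))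
end General

/-- **Theorem.** Let `A` be a basic finite dimensional algebra over an algebraically
closed field `k` (encoded by the surjective `k`-algebra map `π : A → (Fin n → k)`
with kernel `rad A`), and let `Ã` be the trivial square-zero extension algebra of
the construction.  If injectives generate for `Ã`, then injectives generate for `A`. -/
theorem injectives_generate_of_injectives_generate_constr
    (k : Type u) [Field k] [IsAlgClosed k] (n : ℕ)
    (A : Type u) [Ring A] [Algebra k A] [FiniteDimensional k A]
    (π : A →ₐ[k] (Fin n → k)) (hsurj : Function.Surjective π)
    (hker : RingHom.ker π = Ideal.jacobson (⊥ : Ideal A)) :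
    letI := constrLeftModule k n A
    letI := constrRightModule k n A π
    letI := constrSMulCommClass k n A π
    InjectivesGenerate (TrivSqZeroExt (A × ConstrB k n) (Fin n → k)) →
      InjectivesGenerate A := by
  letI := constrLeftModule k n A
  letI := constrRightModule k n A π
  letI := constrSMulCommClass k n A π
  let q : TrivSqZeroExt (A × ConstrB k n) (Fin n → k) →+* A :=
    { toFun := fun x => x.fst.1
      map_one' := rfl
      map_mul' := fun _ _ => rfl
      map_zero' := rfl
      map_add' := fun _ _ => rfl }
  let τ : Aᵐᵒᵖ →ₙ+* (TrivSqZeroExt (A × ConstrB k n) (Fin n → k))ᵐᵒᵖ :=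
    { toFun := fun a => op (inl (unop a, 0))
      map_mul' := fun a b => by
        rw [← MulOpposite.op_mul, inl_mul_inl, Prod.mk_mul_mk, mul_zero, MulOpposite.unop_mul]
      map_zero' := rfl
      map_add' := fun a b => by
        rw [← MulOpposite.op_add, ← inl_add, Prod.mk_add_mk, add_zero, MulOpposite.unop_add] }
  refine coext_general q.op τ (fun r => ?_) (fun s => rfl)
  apply unop_injective
  refine TrivSqZeroExt.ext ?_ ?_
  · refine Prod.ext ?_ ?_
    · exact one_mul _
    · exact zero_mul _
  · change ((1, 0) : A × ConstrB k n) • (unop r).snd + op (unop r).fst • (0 : Fin n → k) = 0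
    rw [smul_zero, add_zero]
    change constrBproj k n 0 * (unop r).snd = 0
    rw [map_zero, zero_mul]
end
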